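/- arXiv:0810.4457 — 2 statements merged into one kernel-verified Lean document; each statement's English description precedes it below -/
import Mathlib

section
/- Let λ ∈ ℝ be exponentially transcendental, let n ∈ ℕ, and let y = (y₁,…,yₙ) be a tuple of positive real numbers that is multiplicatively independent. Then the transcendence degree of the field ℚ(λ, y₁,…,yₙ, y₁^λ,…,yₙ^λ) over ℚ(λ) is at least n (here yᵢ^λ denotes the real power function exp(λ·log yᵢ)). -/
/-- `x` is exponentially algebraic over `A ⊆ ℝ`: there are `n ≥ 1`, a tuple `xs` with
`xs 0 = x`, and `n` exponential polynomials (polynomials in variables `X₁,…,Xₙ,Y₁,…,Yₙ`,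
with coefficients in the subring generated by `A ∪ ℤ`, where `Yⱼ` stands for `exp Xⱼ`)
vanishing at `(xs, exp xs)` with nonvanishing Jacobian determinant there; the `(i,j)`
Jacobian entry is the total derivative `∂fᵢ/∂Xⱼ + exp(xⱼ)·∂fᵢ/∂Yⱼ` at `(xs, exp xs)`. -/
def IsExpAlgebraicOver (A : Set ℝ) (x : ℝ) : Prop :=
  ∃ (n : ℕ) (hn : 0 < n) (xs : Fin n → ℝ)
    (f : Fin n → MvPolynomial (Fin n ⊕ Fin n) ℝ),
    xs ⟨0, hn⟩ = x ∧
    (∀ i m, MvPolynomial.coeff m (f i) ∈ Subring.closure A) ∧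
    (∀ i, MvPolynomial.eval (Sum.elim xs fun j => Real.exp (xs j)) (f i) = 0) ∧
    (Matrix.of fun i j =>
        MvPolynomial.eval (Sum.elim xs fun j => Real.exp (xs j))
          (MvPolynomial.pderiv (Sum.inl j) (f i)) +
        Real.exp (xs j) *
          MvPolynomial.eval (Sum.elim xs fun j => Real.exp (xs j))
            (MvPolynomial.pderiv (Sum.inr j) (f i))).det ≠ 0

/-- `x` is exponentially algebraic (over `∅`, i.e. with integer coefficients). -/
def IsExpAlgebraic (x : ℝ) : Prop := IsExpAlgebraicOver ∅ x

/-- `td X Y` : the transcendence degree of the field `ℚ(X ∪ Y)` over `ℚ(Y)`,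
realized as the supremum of the cardinalities of subsets of `ℚ(X ∪ Y)` that are
algebraically independent over `ℚ(Y)`. -/
noncomputable def td {F : Type*} [Field F] (X Y : Set F) : Cardinal :=
  ⨆ s : {s : Set F // s ⊆ ↑(Subfield.closure (X ∪ Y)) ∧
      AlgebraicIndependent ↥(Subfield.closure Y) ((↑) : s → F)}, Cardinal.mk s.1

/-- A derivation vanishing on a field of characteristic zero vanishes on everything algebraic
over that field. -/
theorem Derivation.eq_zero_of_isAlgebraic {R F L M : Type*} [CommRing R] [Field F] [CharZero F]
    [Field L] [Algebra F L] [Algebra R L] [AddCommGroup M] [Module L M] [Module R M]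
    (δ : Derivation R L M)
    (h : ∀ a : F, δ (algebraMap F L a) = 0) {x : L} (hx : IsAlgebraic F x) : δ x = 0 := by
  have key : ∀ p : Polynomial F, δ (Polynomial.aeval x p) =
      Polynomial.aeval x (Polynomial.derivative p) • δ x := by
    intro p
    induction p using Polynomial.induction_on' with
    | add p q hp hq => simp [hp, hq, add_smul]
    | monomial n a =>
      simp only [Polynomial.aeval_monomial, Polynomial.derivative_monomial, Derivation.leibniz, h,
        Derivation.leibniz_pow, smul_zero, add_zero, map_mul]
      rw [← Nat.cast_smul_eq_nsmul L, smul_smul, smul_smul]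
      ring_nf
      simp
      ring_nf
  have h1 := key (minpoly F x)
  rw [minpoly.aeval, map_zero] at h1
  have hsep : (minpoly F x).Separable := (minpoly.irreducible hx.isIntegral).separable
  exact (smul_eq_zero.1 h1.symm).resolve_left
    (hsep.aeval_derivative_ne_zero (minpoly.aeval F x))

/-- The field of constants of a derivation. -/
def Derivation.constants {k L : Type*} [Field k] [Field L] [Algebra k L] (δ : Derivation k L L) :
    IntermediateField k L where
  carrier := {x | δ x = 0}
  mul_mem' {a b} ha hb := by simp_all
  add_mem' {a b} ha hb := by simp_all
  algebraMap_mem' r := by simp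
  inv_mem' a ha := by simp_all [Derivation.leibniz_inv]

theorem Algebra.FormallySmooth.of_charZero (K L : Type*) [Field K] [CharZero K] [Field L]
    [Algebra K L] : Algebra.FormallySmooth K L := by
  obtain ⟨s, hs⟩ := exists_isTranscendenceBasis K L
  have := hs.isAlgebraic_field
  exact .of_algebraicIndependent_of_isSeparable hs.1

theorem Derivation.exists_extension {k A L : Type*} [CommRing k] [CommRing A] [Field L]
    [Algebra k A] [Algebra A L] [Algebra k L] [IsScalarTower k A L] [Algebra.FormallySmooth A L]
    (δ : Derivation k A L) : ∃ δ' : Derivation k L L, ∀ a, δ' (algebraMap A L a) = δ a := by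
  have hinj : Function.Injective (KaehlerDifferential.mapBaseChange k A L) := by
    rw [injective_iff_map_eq_zero]
    intro x hx
    obtain ⟨y, rfl⟩ := (Algebra.H1Cotangent.exact_δ_mapBaseChange (R := k) (S := A) (T := L) x).1 hx
    have := Algebra.FormallySmooth.subsingleton_h1Cotangent (R := A) (A := L)
    rw [Subsingleton.elim y 0, map_zero]
  obtain ⟨g, hg⟩ := (KaehlerDifferential.mapBaseChange k A L).exists_leftInverse_of_injective
    (LinearMap.ker_eq_bot.2 hinj)
  let f := (LinearMap.liftBaseChange L δ.liftKaehlerDifferential).comp g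
  refine ⟨f.compDer (KaehlerDifferential.D k L), fun a => ?_⟩
  have h1 : KaehlerDifferential.D k L (algebraMap A L a) =
      KaehlerDifferential.mapBaseChange k A L (1 ⊗ₜ KaehlerDifferential.D k A a) := by
    simp
  have h2 := LinearMap.congr_fun hg (1 ⊗ₜ KaehlerDifferential.D k A a)
  simp only [LinearMap.comp_apply, LinearMap.id_apply] at h2
  change LinearMap.liftBaseChange L δ.liftKaehlerDifferential
    (g (KaehlerDifferential.D k L (algebraMap A L a))) = _
  rw [h1, h2]
  simp

theorem Derivation.exists_apply_eq_one_of_transcendental {k L : Type*} [Field k] [CharZero k]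
    [Field L] [Algebra k L] {T : L} (hT : Transcendental k T) :
    ∃ δ : Derivation k L L, δ T = 1 := by
  let i : Algebra (Polynomial k) L := (Polynomial.aeval T).toAlgebra
  have hi : ∀ p : Polynomial k, algebraMap (Polynomial k) L p = Polynomial.aeval T p := fun _ => rfl
  have : IsScalarTower k (Polynomial k) L := .of_algebraMap_eq fun x => by simp [hi]
  have hinj : Function.Injective (algebraMap (Polynomial k) L) :=
    transcendental_iff_injective.1 hT
  have : FaithfulSMul (Polynomial k) L := (faithfulSMul_iff_algebraMap_injective _ _).2 hinj
  let j : Algebra (FractionRing (Polynomial k)) L := FractionRing.liftAlgebra _ _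
  have : IsScalarTower (Polynomial k) (FractionRing (Polynomial k)) L :=
    FractionRing.isScalarTower_liftAlgebra _ _
  have := Algebra.FormallySmooth.of_charZero (FractionRing (Polynomial k)) L
  have : Algebra.FormallySmooth (Polynomial k) (FractionRing (Polynomial k)) :=
    .of_isLocalization (nonZeroDivisors _)
  have : Algebra.FormallySmooth (Polynomial k) L := .comp _ (FractionRing (Polynomial k)) _
  obtain ⟨δ, hδ⟩ := (Polynomial.mkDerivation k (1 : L)).exists_extension
  refine ⟨δ, ?_⟩
  have := hδ Polynomial.X
  simpa [hi] using this

section Residue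

open Polynomial

variable {k L : Type*} [Field k] [Field L] [Algebra k L] {T : L}

/-- The ring of rational functions in `T` over `k` without a pole at `T = 0`. -/
def regularSubring (k : Type*) {L : Type*} [Field k] [Field L] [Algebra k L] (T : L) :
    Subring L where
  carrier := {f | ∃ P Q : k[X], Q.eval 0 ≠ 0 ∧ f * aeval T Q = aeval T P}
  mul_mem' := by
    rintro f g ⟨P, Q, hQ, h⟩ ⟨P', Q', hQ', h'⟩
    refine ⟨P * P', Q * Q', by simp [hQ, hQ'], ?_⟩
    simp only [map_mul, ← h, ← h']
    ring
  add_mem' := by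
    rintro f g ⟨P, Q, hQ, h⟩ ⟨P', Q', hQ', h'⟩
    refine ⟨P * Q' + P' * Q, Q * Q', by simp [hQ, hQ'], ?_⟩
    simp only [map_mul, map_add, ← h, ← h']
    ring
  one_mem' := ⟨1, 1, by simp, by simp⟩
  zero_mem' := ⟨0, 1, by simp, by simp⟩
  neg_mem' := by
    rintro f ⟨P, Q, hQ, h⟩
    exact ⟨-P, Q, hQ, by simp [← h]⟩

theorem aeval_mem_regularSubring (P : k[X]) : aeval T P ∈ regularSubring k T :=
  ⟨P, 1, by simp, by simp⟩

theorem algebraMap_mem_regularSubring (c : k) : algebraMap k L c ∈ regularSubring k T := by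
  simpa using aeval_mem_regularSubring (T := T) (C c)

theorem self_mem_regularSubring : T ∈ regularSubring k T := by
  simpa using aeval_mem_regularSubring (k := k) (T := T) X

theorem aeval_ne_zero_of_transcendental (hT : Transcendental k T) {Q : k[X]} (hQ : Q ≠ 0) :
    aeval T Q ≠ 0 := fun h => hQ ((transcendental_iff.1 hT) Q h)

theorem deriv_mem_regularSubring (D : Derivation k L L) (hD : D T = 1)
    {f : L} (hf : f ∈ regularSubring k T) : D f ∈ regularSubring k T := by
  obtain ⟨P, Q, hQ, h⟩ := hf
  refine ⟨derivative P * Q - P * derivative Q, Q * Q, by simp [hQ], ?_⟩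
  have h1 := congrArg D h
  simp only [Derivation.leibniz, Derivation.map_aeval, hD, smul_eq_mul, mul_one] at h1
  simp only [map_sub, map_mul, ← h, ← h1]
  ring

theorem eq_zero_of_self_mul_eq_algebraMap (hT : Transcendental k T) {f : L}
    (hf : f ∈ regularSubring k T) {c : k} (h : T * f = algebraMap k L c) : c = 0 := by
  obtain ⟨P, Q, hQ, h'⟩ := hf
  have h1 : aeval T (X * P) = aeval T (C c * Q) := by
    simp only [map_mul, aeval_X, aeval_C, ← h, ← h']
    ring
  have h2 := congrArg (eval 0) (transcendental_iff_injective.1 hT h1)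
  simpa [hQ] using h2

theorem exists_eq_zpow_mul (hT : Transcendental k T) {f : L}
    (hf : f ∈ IntermediateField.adjoin k {T}) (hf0 : f ≠ 0) :
    ∃ (a : ℤ) (w : L), w ∈ regularSubring k T ∧ w⁻¹ ∈ regularSubring k T ∧ w ≠ 0 ∧
      f = T ^ a * w := by
  obtain ⟨P, Q, rfl⟩ := (IntermediateField.mem_adjoin_simple_iff k f).1 hf
  have hP : P ≠ 0 := by rintro rfl; simp at hf0
  have hQ : Q ≠ 0 := by rintro rfl; simp at hf0
  have hT0 : T ≠ 0 := by
    rintro rfl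
    exact hT (isAlgebraic_zero)
  obtain ⟨P₁, hP₁, hP₁'⟩ := exists_eq_pow_rootMultiplicity_mul_and_not_dvd P hP 0
  obtain ⟨Q₁, hQ₁, hQ₁'⟩ := exists_eq_pow_rootMultiplicity_mul_and_not_dvd Q hQ 0
  rw [dvd_iff_isRoot, IsRoot.def] at hP₁' hQ₁'
  have hP₀ := aeval_ne_zero_of_transcendental (T := T) hT (Q := P₁) (by rintro rfl; simp at hP₁')
  have hQ₀ := aeval_ne_zero_of_transcendental (T := T) hT (Q := Q₁) (by rintro rfl; simp at hQ₁')
  refine ⟨(rootMultiplicity 0 P : ℤ) - rootMultiplicity 0 Q, aeval T P₁ / aeval T Q₁,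
    ⟨P₁, Q₁, hQ₁', by field_simp⟩, ⟨Q₁, P₁, hP₁', by field_simp⟩, by positivity, ?_⟩
  conv_lhs => rw [hP₁, hQ₁]
  simp only [map_mul, map_pow, aeval_X, C_0, sub_zero]
  rw [zpow_sub₀ hT0, zpow_natCast, zpow_natCast]
  field_simp

theorem sum_mul_order_eq_zero [CharZero k] (hT : Transcendental k T) (D : Derivation k L L)
    (hD : D T = 1) {ι : Type*} [Fintype ι] (b : ι → k) (a : ι → ℤ) (w : ι → L)
    (hw : ∀ i, w i ∈ regularSubring k T) (hw' : ∀ i, (w i)⁻¹ ∈ regularSubring k T)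
    (hw0 : ∀ i, w i ≠ 0) {V : L} (hV : V ∈ IntermediateField.adjoin k {T})
    (h : ∑ i, algebraMap k L (b i) * (D (T ^ a i * w i) / (T ^ a i * w i)) = D V) :
    ∑ i, b i * a i = 0 := by
  have : CharZero L := charZero_of_injective_algebraMap (algebraMap k L).injective
  have hT0 : T ≠ 0 := by
    rintro rfl
    exact hT (isAlgebraic_zero)
  obtain ⟨r, hr, hr'⟩ : ∃ r ∈ regularSubring k T,
      algebraMap k L (∑ i, b i * a i) + T * r = T * D V := by
    refine ⟨∑ i, algebraMap k L (b i) * (D (w i) * (w i)⁻¹), sum_mem fun i _ => mul_mem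
      (algebraMap_mem_regularSubring _) (mul_mem (deriv_mem_regularSubring D hD (hw i)) (hw' i)),
      ?_⟩
    rw [← h, Finset.mul_sum, Finset.mul_sum, map_sum, ← Finset.sum_add_distrib]
    refine Finset.sum_congr rfl fun i _ => ?_
    have := hw0 i
    have h3 : T ^ a i ≠ 0 := zpow_ne_zero _ hT0
    simp only [Derivation.leibniz, Derivation.leibniz_zpow, hD, smul_eq_mul, map_mul, map_intCast,
      zsmul_eq_mul, mul_one]
    rw [zpow_sub_one₀ hT0]
    field_simp
    ring
  by_cases hV0 : V = 0
  · refine eq_zero_of_self_mul_eq_algebraMap hT (neg_mem hr) ?_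
    simp only [hV0, map_zero, mul_zero] at hr'
    linear_combination -hr'
  obtain ⟨n, v, hv, hv', hv0, rfl⟩ := exists_eq_zpow_mul hT hV hV0
  obtain ⟨n, rfl | rfl⟩ := n.eq_nat_or_neg
  · have h1 : D (T ^ (n : ℤ) * v) ∈ regularSubring k T := by
      rw [zpow_natCast]
      exact deriv_mem_regularSubring D hD (mul_mem (pow_mem self_mem_regularSubring _) hv)
    refine eq_zero_of_self_mul_eq_algebraMap hT (sub_mem h1 hr) ?_
    linear_combination -hr'
  · rcases n with _ | n
    · refine eq_zero_of_self_mul_eq_algebraMap hT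
        (sub_mem (deriv_mem_regularSubring D hD hv) hr) ?_
      simp only [Nat.cast_zero, neg_zero, zpow_zero, one_mul] at hr'
      linear_combination -hr'
    · exfalso
      have h1 := congrArg D (show T ^ (-((n + 1 : ℕ) : ℤ)) * v * T ^ (n + 1) = v by
        rw [zpow_neg, zpow_natCast]; field_simp)
      rw [Derivation.leibniz, Derivation.leibniz_pow, hD] at h1
      have h3 : T ^ (-((n + 1 : ℕ) : ℤ)) * T ^ (n + 1) = 1 := by
        rw [zpow_neg, zpow_natCast]; field_simp
      simp only [smul_eq_mul, nsmul_eq_mul, Nat.add_sub_cancel, mul_one] at h1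
      have h2 : T * (v⁻¹ * (D v - T ^ n * algebraMap k L (∑ i, b i * a i) - T * T ^ n * r)) =
          algebraMap k L ((n + 1 : ℕ) : k) := by
        rw [map_natCast]
        field_simp
        linear_combination (-T) * h1 - T ^ (n+1) * hr' + (n+1 : ℕ) * v * h3
      have h4 := eq_zero_of_self_mul_eq_algebraMap hT (mul_mem hv' (sub_mem (sub_mem
        (deriv_mem_regularSubring D hD hv) (mul_mem (pow_mem self_mem_regularSubring _)
          (algebraMap_mem_regularSubring _))) (mul_mem (mul_mem self_mem_regularSubring
          (pow_mem self_mem_regularSubring _)) hr))) h2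
      norm_cast at h4

end Residue

theorem Derivation.map_prod_div {k L ι : Type*} [Field k] [Field L] [Algebra k L]
    (D : Derivation k L L) (s : Finset ι) (f : ι → L) (hf : ∀ i ∈ s, f i ≠ 0) :
    D (∏ i ∈ s, f i) / ∏ i ∈ s, f i = ∑ i ∈ s, D (f i) / f i := by
  classical
  induction s using Finset.induction_on with
  | empty => simp
  | insert a s ha ih =>
    have h1 : f a ≠ 0 := hf a (Finset.mem_insert_self _ _)
    have h2 : ∏ i ∈ s, f i ≠ 0 :=
      Finset.prod_ne_zero_iff.2 fun i hi => hf i (Finset.mem_insert_of_mem hi)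
    rw [Finset.prod_insert ha, Finset.sum_insert ha,
      ← ih fun i hi => hf i (Finset.mem_insert_of_mem hi), Derivation.leibniz]
    simp only [smul_eq_mul]
    field_simp
    ring

/-- A derivation commutes with the automorphisms of an algebraic extension, as soon as it maps the
ground field to itself. -/
theorem Derivation.apply_algEquiv {k F L : Type*} [Field k] [Field F] [CharZero F] [Field L]
    [Algebra k F] [Algebra k L] [Algebra F L] [IsScalarTower k F L] [Algebra.IsAlgebraic F L]
    (D : Derivation k L L)
    (hD : ∀ a : F, ∃ b : F, D (algebraMap F L a) = algebraMap F L b) (τ : L ≃ₐ[F] L) (x : L) :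
    D (τ x) = τ (D x) := by
  let τ' : L ≃ₐ[k] L := τ.restrictScalars k
  let E : Derivation k L L := Derivation.mk'
    (τ'.symm.toLinearMap ∘ₗ D.toLinearMap ∘ₗ τ'.toLinearMap) fun a b => by
      simp
  have hE (x) : E x = τ.symm (D (τ x)) := rfl
  have h : (E - D) x = 0 := by
    refine Derivation.eq_zero_of_isAlgebraic (F := F) _ (fun a => ?_)
      (Algebra.IsAlgebraic.isAlgebraic x)
    obtain ⟨b, hb⟩ := hD a
    rw [Derivation.sub_apply, hE, AlgEquiv.commutes, hb, AlgEquiv.commutes, sub_self]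
  rw [Derivation.sub_apply, hE, sub_eq_zero, AlgEquiv.symm_apply_eq] at h
  exact h

open IntermediateField in
theorem exists_int_sum_mul_eq_zero_of_isAlgClosed {k L : Type*} [Field k] [CharZero k] [Field L]
    [Algebra k L] [IsAlgClosed L] {T : L} (hT : Transcendental k T)
    [Algebra.IsAlgebraic k⟮T⟯ L]
    (D : Derivation k L L) (hD : D T = 1) {ι : Type*} [Fintype ι] (b : ι → k) (u : ι → L)
    (hu : ∀ i, u i ≠ 0) (v : L) (h : ∑ i, algebraMap k L (b i) * (D (u i) / u i) = D v)
    (i₀ : ι) (hi₀ : u i₀ = T) : ∃ a : ι → ℤ, a i₀ ≠ 0 ∧ ∑ i, b i * a i = 0 := by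
  have : CharZero L := charZero_of_injective_algebraMap (algebraMap k L).injective
  have hT0 : T ≠ 0 := by
    rintro rfl
    exact hT (isAlgebraic_zero)
  have hDF (a : k⟮T⟯) : ∃ b : k⟮T⟯, D (algebraMap k⟮T⟯ L a) = algebraMap k⟮T⟯ L b := by
    obtain ⟨P, Q, hPQ⟩ := (IntermediateField.mem_adjoin_simple_iff k _).1 a.2
    have hm (R : Polynomial k) : Polynomial.aeval T R ∈ k⟮T⟯ := by
      simpa using (Polynomial.aeval (AdjoinSimple.gen k T) R).2
    refine ⟨⟨D (a : L), ?_⟩, rfl⟩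
    rw [hPQ, Derivation.leibniz_div]
    simp only [smul_eq_mul, Derivation.map_aeval, hD, mul_one]
    exact mul_mem (pow_mem (inv_mem (hm Q)) 2) (sub_mem (mul_mem (hm _) (hm _))
      (mul_mem (hm _) (hm _)))
  let M : IntermediateField k⟮T⟯ L := adjoin k⟮T⟯ (insert v (Set.range u))
  have hfin : FiniteDimensional k⟮T⟯ M := by
    have : Finite (insert v (Set.range u) : Set L) := ((Set.finite_range u).insert v).to_subtype
    exact finiteDimensional_adjoin fun x _ => Algebra.IsIntegral.isIntegral x
  let v' : M := ⟨v, subset_adjoin _ _ (Set.mem_insert _ _)⟩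
  let u' (i : ι) : M := ⟨u i, subset_adjoin _ _ (Set.mem_insert_of_mem _ ⟨i, rfl⟩)⟩
  have hu' (i) : u' i ≠ 0 := fun h => hu i (congrArg Subtype.val h)
  have hext (σ : M →ₐ[k⟮T⟯] L) : ∃ τ : L ≃ₐ[k⟮T⟯] L, ∀ x : M, τ x = σ x := by
    obtain ⟨τ, hτ⟩ := IsAlgClosed.surjective_domRestrict_of_isAlgebraic
      (K := k⟮T⟯) (L := M) (E := L) σ
    refine ⟨.ofBijective τ (Algebra.IsAlgebraic.algHom_bijective τ), fun x => ?_⟩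
    rw [← hτ]
    rfl
  choose τ hτ using hext
  have hnorm (i) : algebraMap k⟮T⟯ L (Algebra.norm k⟮T⟯ (u' i)) = ∏ σ : M →ₐ[k⟮T⟯] L, σ (u' i) :=
    Algebra.norm_eq_prod_embeddings _ _ _
  have htrace : algebraMap k⟮T⟯ L (Algebra.trace k⟮T⟯ M v') = ∑ σ : M →ₐ[k⟮T⟯] L, σ v' :=
    trace_eq_sum_embeddings _
  have hN0 (i) : algebraMap k⟮T⟯ L (Algebra.norm k⟮T⟯ (u' i)) ≠ 0 := by
    rw [hnorm]
    exact Finset.prod_ne_zero_iff.2 fun σ _ => by simpa using hu' i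
  have hsum : ∑ i, algebraMap k L (b i) * (D (algebraMap k⟮T⟯ L (Algebra.norm k⟮T⟯ (u' i))) /
      (algebraMap k⟮T⟯ L (Algebra.norm k⟮T⟯ (u' i)))) =
      D (algebraMap k⟮T⟯ L (Algebra.trace k⟮T⟯ M v')) := by
    have h1 (i) : D (algebraMap k⟮T⟯ L (Algebra.norm k⟮T⟯ (u' i))) /
      (algebraMap k⟮T⟯ L (Algebra.norm k⟮T⟯ (u' i))) = ∑ σ, τ σ (D (u i) / u i) := by
      rw [hnorm, Derivation.map_prod_div _ _ _ fun σ _ => by simpa using hu' i]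
      refine Finset.sum_congr rfl fun σ _ => ?_
      rw [← hτ σ, Derivation.apply_algEquiv D hDF, map_div₀]
    simp only [h1, htrace, map_sum, Finset.mul_sum]
    rw [Finset.sum_comm]
    refine Finset.sum_congr rfl fun σ _ => ?_
    rw [← hτ σ, Derivation.apply_algEquiv D hDF]
    change _ = τ σ (D v)
    rw [← h, map_sum]
    refine Finset.sum_congr rfl fun i _ => ?_
    rw [map_mul, IsScalarTower.algebraMap_apply k k⟮T⟯ L, AlgEquiv.commutes]
  have hdec (i) := exists_eq_zpow_mul hT (Algebra.norm k⟮T⟯ (u' i)).2 (hN0 i)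
  choose a w hw hw' hw0 haw using hdec
  let n := Module.finrank k⟮T⟯ M
  have hn : n ≠ 0 := Module.finrank_pos.ne'
  have hi₁ : (Algebra.norm k⟮T⟯ (u' i₀) : L) = T ^ n := by
    have : u' i₀ = algebraMap k⟮T⟯ M (AdjoinSimple.gen k T) := Subtype.ext hi₀
    rw [this, Algebra.norm_algebraMap]
    rfl
  classical
  refine ⟨fun i => if i = i₀ then n else a i, by simpa using hn, ?_⟩
  refine sum_mul_order_eq_zero hT D hD b _ (fun i => if i = i₀ then 1 else w i) ?_ ?_ ?_
    (Algebra.trace k⟮T⟯ M v').2 ?_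
  · intro i
    split_ifs
    exacts [one_mem _, hw i]
  · intro i
    split_ifs
    exacts [by simp [one_mem], hw' i]
  · intro i
    split_ifs
    exacts [one_ne_zero, hw0 i]
  · refine Eq.trans ?_ hsum
    refine Finset.sum_congr rfl fun i _ => ?_
    split_ifs with hi
    · subst hi
      simp only [zpow_natCast, mul_one]
      rw [← hi₁]
      rfl
    · rw [← haw]
      rfl

open IntermediateField in
/-- If `∑ bᵢ dlog uᵢ` is exact over a function field of transcendence degree one, the `bᵢ` being
constants, then the residues at a zero of `T = u i₀` give a nontrivial relation between them. -/
theorem exists_int_sum_mul_eq_zero {k L : Type*} [Field k] [CharZero k] [Field L]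
    [Algebra k L] {T : L} (hT : Transcendental k T) [Algebra.IsAlgebraic k⟮T⟯ L]
    (D : Derivation k L L) (hD : D T = 1) {ι : Type*} [Fintype ι] (b : ι → k) (u : ι → L)
    (hu : ∀ i, u i ≠ 0) (v : L) (h : ∑ i, algebraMap k L (b i) * (D (u i) / u i) = D v)
    (i₀ : ι) (hi₀ : u i₀ = T) : ∃ a : ι → ℤ, a i₀ ≠ 0 ∧ ∑ i, b i * a i = 0 := by
  have : CharZero L := charZero_of_injective_algebraMap (algebraMap k L).injective
  let Ω := AlgebraicClosure L
  have := Algebra.FormallySmooth.of_charZero L Ω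
  obtain ⟨D', hD'⟩ := ((Algebra.linearMap L Ω).compDer D).exists_extension
  replace hD' (x : L) : D' (algebraMap L Ω x) = algebraMap L Ω (D x) := hD' x
  have hT' : Transcendental k (algebraMap L Ω T) :=
    (transcendental_algebraMap_iff (algebraMap L Ω).injective).2 hT
  have halg : Algebra.IsAlgebraic k⟮algebraMap L Ω T⟯ Ω := by
    have h1 : Algebra.IsAlgebraic k⟮T⟯ Ω := Algebra.IsAlgebraic.trans k⟮T⟯ L Ω
    have h2 (x : k⟮T⟯) : algebraMap L Ω x ∈ k⟮algebraMap L Ω T⟯ := by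
      have h3 : k⟮algebraMap L Ω T⟯ = k⟮T⟯.map (IsScalarTower.toAlgHom k L Ω) := by
        rw [adjoin_map]
        simp
      rw [h3]
      exact ⟨x, x.2, rfl⟩
    let f : k⟮T⟯ →+* k⟮algebraMap L Ω T⟯ :=
      ((algebraMap L Ω).comp (algebraMap k⟮T⟯ L)).codRestrict _ h2
    exact h1.ringHom_of_comp_eq f (RingHom.id Ω) f.injective Function.surjective_id rfl
  refine exists_int_sum_mul_eq_zero_of_isAlgClosed hT' D' ?_ b (fun i => algebraMap L Ω (u i)) ?_
    (algebraMap L Ω v) ?_ i₀ (by rw [hi₀])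
  · rw [hD', hD, map_one]
  · simpa using hu
  · simp only [hD', ← h, map_sum, map_mul, map_div₀]
    rfl

open IntermediateField IntermediateField.algebraAdjoinAdjoin in
theorem Transcendental.exists_intermediateField {k L : Type*} [Field k] [Field L] [Algebra k L]
    {T : L} (hT : Transcendental k T) :
    ∃ F : IntermediateField k L, Transcendental F T ∧ Algebra.IsAlgebraic F⟮T⟯ L := by
  have h1 : AlgebraicIndepOn k id {T} := by
    rw [AlgebraicIndepOn, algebraicIndependent_singleton_iff ⟨T, rfl⟩]
    exact hT
  obtain ⟨B, hTB, hB⟩ := exists_isTranscendenceBasis_superset h1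
  rw [Set.singleton_subset_iff] at hTB
  refine ⟨adjoin k (B \ {T}), ?_, ?_⟩
  · have := hB.1.transcendental_adjoin (s := {⟨T, hTB⟩}ᶜ) (i := ⟨T, hTB⟩) (by simp)
    have h2 : Subtype.val '' ({⟨T, hTB⟩}ᶜ : Set B) = B \ {T} := by
      ext; simp [and_comm]
    rw [h2] at this
    exact fun h => this ((IsFractionRing.isAlgebraic_iff _ (adjoin k (B \ {T})) _).2 h)
  · have h2 := hB.isAlgebraic_field
    have h3 : adjoin k (Set.range ((↑) : B → L)) ≤
        (adjoin (adjoin k (B \ {T})) {T}).restrictScalars k := by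
      rw [adjoin_adjoin_left]
      exact adjoin.mono _ _ _ (by simp)
    exact h2.ringHom_of_comp_eq (inclusion h3).toRingHom (RingHom.id L) (inclusion h3).injective
      Function.surjective_id rfl

/-- For a derivation `δ`, the `ℚ`-linear map `x ↦ δ(eˣ)/eˣ - δ x`. -/
noncomputable def expDefect {k : Type*} [Field k] [Algebra k ℝ] (δ : Derivation k ℝ ℝ) :
    ℝ →ₗ[ℚ] ℝ :=
  AddMonoidHom.toRatLinearMap <| AddMonoidHom.mk'
    (fun x => δ (Real.exp x) / Real.exp x - δ x) fun x y => by
      simp only [Real.exp_add, Derivation.leibniz, map_add, smul_eq_mul]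
      field_simp
      ring

theorem expDefect_apply {k : Type*} [Field k] [Algebra k ℝ] (δ : Derivation k ℝ ℝ) (x : ℝ) :
    expDefect δ x = δ (Real.exp x) / Real.exp x - δ x := rfl

/-- An `E`-derivation of the real exponential field. -/
def Derivation.IsExponential (δ : Derivation ℚ ℝ ℝ) : Prop :=
  ∀ x, δ (Real.exp x) = Real.exp x * δ x

open IntermediateField in
theorem eq_zero_of_sum_mul_expDefect {d : Derivation ℚ ℝ ℝ} (hd : d.IsExponential)
    {ι : Type*} [Fintype ι] (z : ι → ℝ)
    (hz : ∀ q : ι → ℚ, ∑ i, q i • z i ∈ d.constants → q = 0)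
    (c : ι → d.constants)
    (h : ∀ δ : Derivation d.constants ℝ ℝ, ∑ i, (c i : ℝ) * expDefect δ (z i) = 0) : c = 0 := by
  classical
  by_contra hc
  obtain ⟨i₁, hi₁⟩ := Function.ne_iff.1 hc
  let S := Submodule.span ℚ (Set.range c)
  have : FiniteDimensional ℚ S := FiniteDimensional.span_of_finite ℚ (Set.finite_range c)
  let b := Module.finBasis ℚ S
  let c' (i : ι) : S := ⟨c i, Submodule.subset_span ⟨i, rfl⟩⟩
  let m (i : ι) := b.repr (c' i)
  have hcm (i : ι) : c i = ∑ j, m i j • (b j : d.constants) := by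
    have := congrArg Subtype.val (b.sum_repr (c' i))
    refine this.symm.trans ?_
    simp only [AddSubmonoidClass.coe_finsetSum, Submodule.coe_smul, m]
  obtain ⟨j₀, hj₀⟩ : ∃ j₀, m i₁ j₀ ≠ 0 := by
    by_contra! h0
    exact hi₁ (by simp [hcm, h0])
  let w (j) : ℝ := ∑ i, m i j • z i
  have hw : d (w j₀) ≠ 0 := fun h0 => hj₀ (congrFun (hz (fun i => m i j₀) h0) i₁)
  have hrel (δ : Derivation d.constants ℝ ℝ) :
      ∑ j, ((b j : d.constants) : ℝ) * expDefect δ (w j) = 0 := by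
    rw [← h δ]
    simp only [w, map_sum, map_smul, hcm, Finset.mul_sum, AddSubmonoidClass.coe_finsetSum,
      Finset.sum_mul]
    rw [Finset.sum_comm]
    refine Finset.sum_congr rfl fun i _ => Finset.sum_congr rfl fun j _ => ?_
    simp [Rat.smul_def]
    ring
  have hT : Transcendental d.constants (Real.exp (w j₀)) := fun halg => by
    have := Derivation.eq_zero_of_isAlgebraic d (fun a => a.2) halg
    rw [hd] at this
    exact mul_ne_zero (Real.exp_pos _).ne' hw this
  obtain ⟨F, hF, hF'⟩ := hT.exists_intermediateField
  obtain ⟨D, hD⟩ := Derivation.exists_apply_eq_one_of_transcendental hF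
  have h1 := hrel (D.restrictScalars d.constants)
  obtain ⟨a, ha, ha'⟩ := exists_int_sum_mul_eq_zero hF D hD
    (fun j => algebraMap d.constants F (b j))
    (fun j => Real.exp (w j)) (fun j => (Real.exp_pos _).ne')
    (∑ j, ((b j : d.constants) : ℝ) * w j) (by
      rw [← sub_eq_zero, map_sum, ← Finset.sum_sub_distrib, ← h1]
      refine Finset.sum_congr rfl fun j _ => ?_
      have h2 : D ((b j : d.constants) : ℝ) = 0 := D.map_algebraMap (algebraMap d.constants F (b j))
      rw [Derivation.leibniz, h2, expDefect_apply]
      simp only [smul_eq_mul]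
      change ((b j : d.constants) : ℝ) * _ - _ = ((b j : d.constants) : ℝ) * (D _ / _ - D _)
      ring) j₀ rfl
  have h3 : ∑ j, (a j : ℚ) • b j = 0 := by
    apply Subtype.ext
    apply (algebraMap d.constants F).injective
    rw [Submodule.coe_zero, map_zero, ← ha']
    simp [Rat.smul_def, mul_comm]
  have h4 := Fintype.linearIndependent_iff.1 b.linearIndependent _ h3 j₀
  exact ha (by exact_mod_cast h4)

/-- A derivation, regarded as linear over its field of constants. -/
def Derivation.overConstants {k L : Type*} [Field k] [Field L] [Algebra k L]
    (δ : Derivation k L L) : Derivation δ.constants L L :=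
  Derivation.mk'
    { toFun := δ
      map_add' := map_add δ
      map_smul' := fun c x => by
        have hc : δ (c : L) = 0 := c.2
        simp [Algebra.smul_def, hc, IntermediateField.algebraMap_apply] }
    fun a b => δ.leibniz a b

theorem Derivation.overConstants_apply {k L : Type*} [Field k] [Field L] [Algebra k L]
    (δ : Derivation k L L) (x : L) : δ.overConstants x = δ x := rfl

theorem Derivation.IsExponential.apply_expDefect {d : Derivation ℚ ℝ ℝ} (hd : d.IsExponential)
    (δ : Derivation d.constants ℝ ℝ) (x : ℝ) :
    d (expDefect δ x) = expDefect ⁅d.overConstants, δ⁆ x := by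
  have h1 : δ (d (Real.exp x)) = δ (Real.exp x * d x) := by rw [hd]
  simp only [expDefect_apply, map_sub, Derivation.leibniz_div, Derivation.commutator_apply,
    Derivation.overConstants_apply, hd x, Derivation.leibniz, smul_eq_mul]
  field_simp
  ring

/-- A family of functionals vanishing on a common vector not killed by `ev` is dependent
as soon as all its members factor through `ev`, whose target is not larger than the family. -/
theorem exists_sum_mul_eq_zero_of_card_le {K V ι κ : Type*} [Field K] [AddCommGroup V] [Module K V]
    [Fintype ι] [Fintype κ] (hcard : Fintype.card κ ≤ Fintype.card ι)
    (ev : V →ₗ[K] κ → K) (om : V →ₗ[K] ι → K) (hker : LinearMap.ker ev ≤ LinearMap.ker om)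
    {v : V} (hv : ev v ≠ 0) (hv' : om v = 0) :
    ∃ f : ι → K, f ≠ 0 ∧ ∀ x, ∑ i, f i * om x i = 0 := by
  obtain ⟨g, hg⟩ := LinearMap.exists_extend ((LinearMap.ker ev).liftQ om hker ∘ₗ
      ev.quotKerEquivRange.symm.toLinearMap)
  have hg' (x) : g (ev x) = om x := by
    have := LinearMap.congr_fun hg ⟨ev x, ev.mem_range_self x⟩
    refine this.trans ?_
    simp only [LinearMap.comp_apply, LinearEquiv.coe_coe]
    rw [LinearMap.quotKerEquivRange_symm_apply_image]
    simp
  have hinj : LinearMap.ker g ≠ ⊥ := fun h => hv (LinearMap.ker_eq_bot'.1 h _ (by rw [hg', hv']))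
  have hsurj : LinearMap.range g < ⊤ := by
    rw [lt_top_iff_ne_top]
    intro h
    have h1 := g.finrank_range_add_finrank_ker
    have h2 : 0 < Module.finrank K (LinearMap.ker g) := by
      rw [Nat.pos_iff_ne_zero]
      exact fun h => hinj (Submodule.finrank_eq_zero.1 h)
    rw [h, finrank_top] at h1
    simp only [Module.finrank_fintype_fun_eq_card] at h1
    omega
  obtain ⟨φ, hφ, hφ'⟩ := Submodule.exists_le_ker_of_lt_top _ hsurj
  classical
  have hsum (y : ι → K) : φ y = ∑ i, φ (Pi.single i 1) * y i := by
    conv_lhs => rw [pi_eq_sum_univ' y, map_sum]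
    refine Finset.sum_congr rfl fun i _ => ?_
    rw [map_smul, smul_eq_mul, mul_comm]
  refine ⟨fun i => φ (Pi.single i 1), fun h => hφ ?_, fun x => ?_⟩
  · ext i
    exact congrFun h i
  · rw [← hsum, ← hg']
    exact hφ' ⟨_, rfl⟩

theorem card_lt_of_forall_expDefect_eq_zero {d : Derivation ℚ ℝ ℝ} (hd : d.IsExponential)
    {ι κ : Type*} [Fintype ι] [Fintype κ] (z : ι → ℝ)
    (hz : ∀ q : ι → ℚ, ∑ i, q i • z i ∈ d.constants → q = 0)
    (B : κ → ℝ) (hdB : ∃ k, d (B k) ≠ 0)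
    (hB : ∀ δ : Derivation d.constants ℝ ℝ, (∀ k, δ (B k) = 0) → ∀ i, expDefect δ (z i) = 0) :
    Fintype.card ι < Fintype.card κ := by
  classical
  by_contra! hcard
  let ev : Derivation d.constants ℝ ℝ →ₗ[ℝ] κ → ℝ :=
    { toFun := fun δ k => δ (B k), map_add' := fun _ _ => rfl, map_smul' := fun _ _ => rfl }
  let om : Derivation d.constants ℝ ℝ →ₗ[ℝ] ι → ℝ :=
    { toFun := fun δ i => expDefect δ (z i)
      map_add' := fun _ _ => by ext; simp [expDefect_apply]; ring
      map_smul' := fun _ _ => by ext; simp [expDefect_apply]; ring }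
  obtain ⟨f₀, hf₀, hf₀'⟩ := exists_sum_mul_eq_zero_of_card_le hcard ev om
    (fun δ hδ => funext fun i => hB δ (fun k => congrFun hδ k) i) (v := d.overConstants)
    (fun h => hdB.elim fun k hk => hk (congrFun h k))
    (funext fun i => by
      change expDefect _ _ = 0
      rw [expDefect_apply, Derivation.overConstants_apply, Derivation.overConstants_apply, hd]
      simp)
  let P (n : ℕ) : Prop := ∃ f : ι → ℝ, f ≠ 0 ∧ (∀ δ, ∑ i, f i * om δ i = 0) ∧
    (Finset.univ.filter fun i => f i ≠ 0).card = n
  have hP : ∃ n, P n := ⟨_, f₀, hf₀, hf₀', rfl⟩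
  obtain ⟨f, hf, hf', hfn⟩ := Nat.find_spec hP
  obtain ⟨i₀, hi₀⟩ := Function.ne_iff.1 hf
  change f i₀ ≠ 0 at hi₀
  let g (i : ι) := f i / f i₀
  have hg (δ) : ∑ i, g i * om δ i = 0 := by
    have := congrArg (· / f i₀) (hf' δ)
    simpa [Finset.sum_div, g, div_mul_eq_mul_div] using this
  have hdg (δ : Derivation d.constants ℝ ℝ) : ∑ i, d (g i) * om δ i = 0 := by
    have h1 := congrArg d (hg δ)
    have h2 := hg ⁅d.overConstants, δ⁆
    have h3 (i) : d (om δ i) = om ⁅d.overConstants, δ⁆ i := hd.apply_expDefect δ (z i)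
    simp only [map_sum, Derivation.leibniz, Finset.sum_add_distrib, h3, smul_eq_mul, h2, map_zero,
      zero_add] at h1
    simpa [mul_comm] using h1
  have hdg0 : ∀ i, d (g i) = 0 := by
    by_contra! hne
    have hmin : Nat.find hP ≤ _ := Nat.find_min' hP
      ⟨fun i => d (g i), Function.ne_iff.2 hne, hdg, rfl⟩
    rw [← hfn] at hmin
    refine hmin.not_gt (Finset.card_lt_card ⟨fun i hi => ?_, fun hs => ?_⟩)
    · simp only [Finset.mem_filter, Finset.mem_univ, true_and] at hi ⊢
      contrapose! hi
      simp [g, hi]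
    · have := hs (Finset.mem_filter.2 ⟨Finset.mem_univ i₀, hi₀⟩)
      simp [g, hi₀] at this
  have := congrFun (eq_zero_of_sum_mul_expDefect hd z hz (fun i => ⟨g i, hdg0 i⟩) hg) i₀
  have := congrArg Subtype.val this
  simp [g, hi₀] at this

/-- A finite transcendence basis, in the form in which derivations see it. -/
theorem exists_finset_of_td_lt {X Y : Set ℝ} {n : ℕ} (h : td X Y < n) :
    ∃ s : Finset ℝ, s.card < n ∧ ∀ (k : Type) [Field k] [Algebra k ℝ] (δ : Derivation k ℝ ℝ),
      (∀ y ∈ Y, δ y = 0) → (∀ y ∈ s, δ y = 0) → ∀ x ∈ X, δ x = 0 := by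
  obtain ⟨u, -, ⟨hu, hut⟩, hmax⟩ := exists_maximal_algebraicIndependent (R := Subfield.closure Y)
    ∅ (Subfield.closure (X ∪ Y) : Set ℝ) (Set.empty_subset _)
    ((algebraicIndependent_empty_iff _ _).2 (FaithfulSMul.algebraMap_injective _ _))
  have hcard : Cardinal.mk u < n := by
    refine lt_of_le_of_lt ?_ h
    exact le_ciSup (f := fun s : {s : Set ℝ // s ⊆ ↑(Subfield.closure (X ∪ Y)) ∧
      AlgebraicIndependent ↥(Subfield.closure Y) ((↑) : s → ℝ)} => Cardinal.mk s.1)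
      Cardinal.bddAbove_of_small ⟨u, hut, hu⟩
  have hfin : u.Finite :=
    Cardinal.lt_aleph0_iff_set_finite.1 (hcard.trans (Cardinal.natCast_lt_aleph0))
  refine ⟨hfin.toFinset, ?_, fun k _ _ δ hY hs x hx => ?_⟩
  · rw [← Set.ncard_eq_toFinset_card u hfin, ← Nat.cast_lt (α := Cardinal), Set.cast_ncard hfin]
    exact hcard
  have hconst : Subfield.closure (Y ∪ u) ≤ (δ.constants).toSubfield := by
    rw [Subfield.closure_le]
    rintro a (ha | ha)
    · exact hY a ha
    · exact hs a (hfin.mem_toFinset.2 ha)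
  have hxu : IsAlgebraic (Algebra.adjoin (Subfield.closure Y) u) x := by
    by_contra hx'
    have h1 := AlgebraicIndepOn.insert (x := id) (i := x) hu (by rwa [Set.image_id])
    have h2 := hmax ⟨h1, Set.insert_subset (Subfield.subset_closure (.inl hx)) hut⟩
      (Set.subset_insert _ _) (Set.mem_insert _ _)
    exact hx' (isAlgebraic_algebraMap (⟨x, Algebra.subset_adjoin h2⟩ :
      Algebra.adjoin (Subfield.closure Y) u))
  have hle (a : Algebra.adjoin (Subfield.closure Y) u) : (a : ℝ) ∈ δ.constants := by
    refine hconst (Algebra.adjoin_induction (fun a ha => Subfield.subset_closure (.inr ha))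
      (fun a => Subfield.closure_mono Set.subset_union_left a.2) (fun _ _ _ _ => add_mem)
      (fun _ _ _ _ => mul_mem) a.2)
  refine Derivation.eq_zero_of_isAlgebraic (F := δ.constants) δ (fun a => a.2) ?_
  exact hxu.ringHom_of_comp_eq (((algebraMap _ ℝ).codRestrict δ.constants hle)) (RingHom.id ℝ)
    (fun a b h => Subtype.ext (congrArg (fun c : δ.constants => (c : ℝ)) h)) rfl

theorem linearIndependent_log {n : ℕ} {y : Fin n → ℝ} (hpos : ∀ i, 0 < y i)
    (hmi : ∀ m : Fin n → ℤ, ∏ i, y i ^ m i = 1 → ∀ i, m i = 0) :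
    LinearIndependent ℚ fun i => Real.log (y i) := by
  rw [← LinearIndependent.iff_fractionRing ℤ ℚ, Fintype.linearIndependent_iff]
  intro m hm
  refine hmi m ?_
  have h1 : 0 < ∏ i, y i ^ m i := Finset.prod_pos fun i _ => zpow_pos (hpos i) _
  rw [← Real.exp_log h1, Real.log_prod (fun i _ => (zpow_pos (hpos i) _).ne')]
  simpa [Real.log_zpow] using hm

section Counting

open Polynomial

variable {K ι : Type*} [Field K] [Algebra K ℝ] [Fintype ι]

/-- The reals `t · (P(t) + ∑ Qᵢ(t) xᵢ)`, where `P` and the `Qᵢ` are polynomials over `K`. -/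
def maximalLattice (K : Type*) [Field K] [Algebra K ℝ] (t : ℝ) (x : ι → ℝ) : Submodule ℚ ℝ where
  carrier := {r | ∃ (P : K[X]) (Q : ι → K[X]), r = t * (aeval t P + ∑ i, aeval t (Q i) * x i)}
  zero_mem' := ⟨0, 0, by simp⟩
  add_mem' := by
    rintro _ _ ⟨P, Q, rfl⟩ ⟨P', Q', rfl⟩
    refine ⟨P + P', Q + Q', ?_⟩
    simp only [Pi.add_apply, map_add, add_mul, Finset.sum_add_distrib]
    ring
  smul_mem' := by
    rintro q _ ⟨P, Q, rfl⟩
    have : CharZero K := (algebraMap K ℝ).charZero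
    refine ⟨C (q : K) * P, fun i => C (q : K) * Q i, ?_⟩
    simp only [map_mul, aeval_C, map_ratCast, Rat.smul_def, mul_assoc, ← Finset.mul_sum]
    ring

theorem mem_maximalLattice_of_inv_mul {t r : ℝ} (ht : t ≠ 0) {x : ι → ℝ} (c : K) (q : ι → ℚ)
    {b : ℝ} (hb : b ∈ maximalLattice K t x)
    (h : t⁻¹ * r + b + ∑ i, q i • x i = algebraMap K ℝ c) : r ∈ maximalLattice K t x := by
  have : CharZero K := (algebraMap K ℝ).charZero
  obtain ⟨P, Q, rfl⟩ := hb
  refine ⟨C c - X * P, fun i => - C (q i : K) - X * Q i, ?_⟩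
  simp only [map_sub, map_neg, aeval_C, map_ratCast, sub_mul, neg_mul, map_mul, aeval_X,
    Finset.sum_sub_distrib, Finset.sum_neg_distrib, ← h, Rat.smul_def, mul_assoc, ← Finset.mul_sum]
  field_simp
  ring

theorem eq_zero_of_mem_maximalLattice {t : ℝ} (ht : Transcendental K t) {x : ι → ℝ}
    (hx : ∀ (P : K[X]) (Q : ι → K[X]), aeval t P + ∑ i, aeval t (Q i) * x i = 0 → Q = 0)
    (c : K) (q : ι → ℚ) {b : ℝ} (hb : b ∈ maximalLattice K t x)
    (h : b + ∑ i, q i • x i = algebraMap K ℝ c) : q = 0 ∧ b = 0 := by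
  have : CharZero K := (algebraMap K ℝ).charZero
  obtain ⟨P, Q, rfl⟩ := hb
  have h1 := hx (X * P - C c) (fun i => X * Q i + C (q i : K)) (by
    simp only [map_sub, map_add, aeval_C, map_ratCast, add_mul, map_mul, aeval_X,
      Finset.sum_add_distrib, ← h, Rat.smul_def, mul_assoc, ← Finset.mul_sum]
    ring)
  have h2 : q = 0 := by
    ext i
    have := congrArg (eval 0) (congrFun h1 i)
    simpa using this
  refine ⟨h2, ?_⟩
  have h3 : Q = 0 := by
    ext1 i
    simpa [h2, X_ne_zero] using congrFun h1 i
  simp only [h3, h2, Pi.zero_apply, map_zero, zero_mul, Finset.sum_const_zero, add_zero,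
    zero_smul] at h ⊢
  have h4 : aeval t (X * P) = aeval t (C c) := by simpa using h
  have h5 := congrArg (eval 0) (transcendental_iff_injective.1 ht h4)
  have h6 : c = 0 := by simpa using h5.symm
  rw [h, h6, map_zero]

end Counting

universe u in
theorem exists_linearIndependent_mod_field {ι : Type u} {L E : Type*} [Fintype ι] [Field L]
    [Field E] [Algebra E L] (x : ι → L) :
    ∃ (κ : Type u) (_ : Fintype κ) (a : κ → ι),
      (∀ (e : E) (c : κ → E), algebraMap E L e + ∑ k, algebraMap E L (c k) * x (a k) = 0 → c = 0) ∧
      ∀ i, ∃ (e : E) (c : κ → E),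
        x i = algebraMap E L e + ∑ k, algebraMap E L (c k) * x (a k) := by
  let S : Submodule E L := Submodule.span E {1}
  have hS (y : L) : y ∈ S ↔ ∃ e : E, algebraMap E L e = y := by
    simp [S, Submodule.mem_span_singleton, Algebra.smul_def]
  obtain ⟨κ, a, ha, hspan, hli⟩ := exists_linearIndependent' E fun i => S.mkQ (x i)
  have : Fintype κ := @Fintype.ofFinite _ (Finite.of_injective a ha)
  refine ⟨κ, this, a, fun e c h => ?_, fun i => ?_⟩
  · rw [Fintype.linearIndependent_iff] at hli
    ext1 k
    refine hli c ?_ k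
    change ∑ k, c k • S.mkQ (x (a k)) = 0
    simp only [← map_smul, ← map_sum]
    rw [Submodule.mkQ_apply, Submodule.Quotient.mk_eq_zero, hS]
    refine ⟨-e, ?_⟩
    simp only [Algebra.smul_def, map_neg]
    linear_combination -h
  · have h1 : S.mkQ (x i) ∈ Submodule.span E (Set.range fun i => S.mkQ (x i)) :=
      Submodule.subset_span ⟨i, rfl⟩
    rw [← hspan, Submodule.mem_span_range_iff_exists_fun] at h1
    obtain ⟨c, hc⟩ := h1
    have h2 : x i - ∑ k, c k • x (a k) ∈ S := by
      rw [← Submodule.Quotient.mk_eq_zero, ← Submodule.mkQ_apply, map_sub, sub_eq_zero, ← hc]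
      simp
    obtain ⟨e, he⟩ := (hS _).1 h2
    refine ⟨e, c, ?_⟩
    rw [he]
    simp [Algebra.smul_def]

theorem le_td_of_isExponential {d : Derivation ℚ ℝ ℝ} (hd : d.IsExponential) {l : ℝ} (hl : d l = 1)
    {n : ℕ} {y : Fin n → ℝ} (hpos : ∀ i, 0 < y i)
    (hmi : ∀ m : Fin n → ℤ, ∏ i, y i ^ m i = 1 → ∀ i, m i = 0) :
    (n : Cardinal) ≤ td (Set.range y ∪ Set.range fun i => y i ^ l) {l} := by
  by_contra! hlt
  obtain ⟨s, hs, hkill⟩ := exists_finset_of_td_lt hlt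
  have hl0 : l ≠ 0 := by
    rintro rfl
    simp at hl
  have hli := linearIndependent_log hpos hmi
  set x : Fin n → ℝ := fun i => Real.log (y i) with hx
  have hlt : Transcendental d.constants l := fun h => by
    have := Derivation.eq_zero_of_isAlgebraic d (fun a : d.constants => a.2) h
    simp [hl] at this
  have ht : Transcendental d.constants l⁻¹ := fun h => hlt (by simpa using h.inv)
  let E := IntermediateField.adjoin d.constants {l}
  have hlE : l ∈ E := IntermediateField.mem_adjoin_simple_self _ _
  obtain ⟨κ, _, a, hind, hgen⟩ := exists_linearIndependent_mod_field (E := E) x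
  have hlat : ∀ (P : Polynomial d.constants) (Q : κ → Polynomial d.constants),
      Polynomial.aeval l⁻¹ P + ∑ i, Polynomial.aeval l⁻¹ (Q i) * x (a i) = 0 → Q = 0 := by
    intro P Q h
    let tE : E := ⟨l⁻¹, E.inv_mem hlE⟩
    have hE (P : Polynomial d.constants) :
        algebraMap E ℝ (Polynomial.aeval tE P) = Polynomial.aeval l⁻¹ P := by
      rw [← Polynomial.aeval_algebraMap_apply]
      rfl
    have := hind (Polynomial.aeval tE P) (fun k => Polynomial.aeval tE (Q k)) (by simpa only [hE])
    ext1 k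
    refine (transcendental_iff.1 ht) _ ?_
    rw [← hE, congrFun this k]
    simp
  let V := Submodule.span ℚ (Set.range x)
  have : FiniteDimensional ℚ V := FiniteDimensional.span_of_finite ℚ (Set.finite_range x)
  have hV : Module.finrank ℚ V = n := by simpa using finrank_span_eq_card hli
  let Wm : Submodule ℚ V := (maximalLattice d.constants l⁻¹ fun k => x (a k)).comap V.subtype
  obtain ⟨Wp, hW⟩ := Wm.exists_isCompl
  have hdim := Submodule.finrank_add_eq_of_isCompl hW
  rw [hV] at hdim
  let bm := Module.finBasis ℚ Wm
  let bp := Module.finBasis ℚ Wp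
  let z : (Fin (Module.finrank ℚ Wm) ⊕ Fin (Module.finrank ℚ Wp)) ⊕ κ → ℝ :=
    Sum.elim (Sum.elim (fun j => (bm j : V)) fun j => l * (bp j : V)) fun k => x (a k)
  have hz (q : (Fin (Module.finrank ℚ Wm) ⊕ Fin (Module.finrank ℚ Wp)) ⊕ κ → ℚ)
      (hq : ∑ i, q i • z i ∈ d.constants) : q = 0 := by
    let b : Wm := ∑ j, q (.inl (.inl j)) • bm j
    let r : Wp := ∑ j, q (.inl (.inr j)) • bp j
    have hb : ((b : V) : ℝ) = ∑ j, q (.inl (.inl j)) • ((bm j : V) : ℝ) := by simp [b]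
    have hr : ((r : V) : ℝ) = ∑ j, q (.inl (.inr j)) • ((bp j : V) : ℝ) := by simp [r]
    have hsum : ∑ i, q i • z i = l * ((r : V) : ℝ) + ((b : V) : ℝ) +
        ∑ k, q (.inr k) • x (a k) := by
      simp only [Fintype.sum_sum_type, z, Sum.elim_inl, Sum.elim_inr, hb, hr, Finset.mul_sum,
        mul_smul_comm]
      ring
    rw [hsum] at hq
    have hrm : ((r : V) : ℝ) ∈ maximalLattice d.constants l⁻¹ fun k => x (a k) := by
      refine mem_maximalLattice_of_inv_mul (inv_ne_zero hl0) ⟨_, hq⟩ (fun k => q (.inr k)) b.2 ?_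
      rw [inv_inv]
      rfl
    have hr0 : r = 0 := Subtype.ext (Submodule.disjoint_def.1 hW.disjoint _ hrm r.2)
    obtain ⟨hq0, hb0⟩ := eq_zero_of_mem_maximalLattice ht hlat ⟨_, hq⟩ (fun k => q (.inr k)) b.2
      (by simp [hr0, IntermediateField.algebraMap_apply])
    have hb0 : b = 0 := Subtype.ext (Subtype.ext hb0)
    ext ((j | j) | j)
    · exact Fintype.linearIndependent_iff.1 bm.linearIndependent _ hb0 j
    · exact Fintype.linearIndependent_iff.1 bp.linearIndependent _ hr0 j
    · exact congrFun hq0 j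
  let B : (Unit ⊕ s) ⊕ κ → ℝ := Sum.elim (Sum.elim (fun _ => l) (↑)) fun k => x (a k)
  have hcard := card_lt_of_forall_expDefect_eq_zero hd z hz B ⟨.inl (.inl ()), by simp [B, hl]⟩ ?_
  · simp only [Fintype.card_sum, Fintype.card_fin, Fintype.card_unit, Fintype.card_coe] at hcard
    omega
  intro δ hδ
  have hδl : δ l = 0 := hδ (.inl (.inl ()))
  have hδa (k : κ) : δ (x (a k)) = 0 := hδ (.inr k)
  have hδy := hkill d.constants δ (by simpa using hδl) fun v hv => hδ (.inl (.inr ⟨v, hv⟩))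
  have hE : ∀ e : E, δ (e : ℝ) = 0 := by
    have : E ≤ δ.constants :=
      IntermediateField.adjoin_le_iff.2 (Set.singleton_subset_iff.2 hδl)
    exact fun e => this e.2
  have hδx (i) : δ (x i) = 0 := by
    obtain ⟨e, c, h⟩ := hgen i
    rw [h]
    simp [IntermediateField.algebraMap_apply, hE, hδa]
  have h1 : V ≤ LinearMap.ker (expDefect δ) := Submodule.span_le.2 <| by
    rintro _ ⟨i, rfl⟩
    have : δ (y i) = 0 := hδy _ (.inl ⟨i, rfl⟩)
    simp [expDefect_apply, hx, Real.exp_log (hpos i), this]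
    exact hδx i
  have h2 : V ≤ LinearMap.ker (expDefect δ ∘ₗ LinearMap.mulLeft ℚ l) := Submodule.span_le.2 <| by
    rintro _ ⟨i, rfl⟩
    have h3 : δ (y i ^ l) = 0 := hδy _ (.inr ⟨i, rfl⟩)
    have h4 : Real.exp (l * x i) = y i ^ l := by rw [Real.rpow_def_of_pos (hpos i), mul_comm]
    simp [expDefect_apply, h4, h3, hδx, hδl]
  rintro ((j | j) | k)
  · exact h1 (bm j : V).2
  · exact h2 (bp j : V).2
  · exact h1 (Submodule.subset_span ⟨a k, rfl⟩)

/-- Finitely many vectors of `kˢ` can be thinned out and completed by coordinate vectors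
to the rows of an invertible matrix. -/
theorem exists_det_ne_zero_of_rows {k σ κ : Type*} [Field k] [Fintype σ] [DecidableEq σ]
    [Finite κ] (g : κ → σ → k) :
    ∃ h : σ → κ ⊕ σ,
      (Matrix.of fun r => Sum.elim g (fun j => Pi.single j 1) (h r)).det ≠ 0 ∧
      ∀ c : σ → k, ∑ r, c r • Sum.elim g (fun j => Pi.single j 1) (h r) ∈
        Submodule.span k (Set.range g) → ∀ r j, h r = .inr j → c r = 0 := by
  set S := Submodule.span k (Set.range g)
  let e (j : σ) : σ → k := Pi.single j 1
  obtain ⟨ι₁, a, ha, haspan, hali⟩ := exists_linearIndependent' k g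
  obtain ⟨ι₂, b, hb, hbspan, hbli⟩ := exists_linearIndependent' k fun j => S.mkQ (e j)
  have : Fintype ι₁ := @Fintype.ofFinite _ (Finite.of_injective a ha)
  have : Fintype ι₂ := @Fintype.ofFinite _ (Finite.of_injective b hb)
  let f (i : ι₁) : S := ⟨g (a i), Submodule.subset_span ⟨a i, rfl⟩⟩
  have hf : LinearIndependent k f := LinearIndependent.of_comp S.subtype hali
  have hli := hf.sumElim_of_quotient (fun j => e (b j)) hbli
  have htop : Submodule.span k (Set.range fun j => S.mkQ (e j)) = ⊤ := by
    have h1 : Submodule.span k (Set.range e) = ⊤ := by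
      have := (Pi.basisFun k σ).span_eq
      rwa [show ⇑(Pi.basisFun k σ) = e from funext fun j => Pi.basisFun_apply k σ j] at this
    rw [Set.range_comp' S.mkQ e, ← Submodule.map_span, h1, Submodule.map_top, Submodule.range_mkQ]
  have hcard : Fintype.card (ι₁ ⊕ ι₂) = Fintype.card σ := by
    have h1 := finrank_span_eq_card hali
    have h2 := finrank_span_eq_card hbli
    rw [haspan] at h1
    rw [hbspan, htop, finrank_top] at h2
    have h3 := Submodule.finrank_quotient_add_finrank S
    rw [Module.finrank_fintype_fun_eq_card] at h3
    rw [Fintype.card_sum, ← h1, ← h2, ← h3, add_comm]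
  let θ : σ ≃ ι₁ ⊕ ι₂ := (Fintype.equivOfCardEq hcard).symm
  refine ⟨fun r => Sum.map a b (θ r), ?_, fun c hc => ?_⟩
  · rw [← isUnit_iff_ne_zero, ← Matrix.isUnit_iff_isUnit_det,
      ← Matrix.linearIndependent_rows_iff_isUnit]
    have h2 : Sum.elim (fun i => (f i : σ → k)) (fun j => e (b j)) ∘ θ =
        fun r => Sum.elim g (fun j => Pi.single j 1) (Sum.map a b (θ r)) := by
      ext1 r
      rcases hr : θ r with i | j <;> simp [hr, f, e]
    exact h2 ▸ hli.comp θ θ.injective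
  · have h1 : ∑ j, c (θ.symm (.inr j)) • S.mkQ (e (b j)) = 0 := by
      rw [← Submodule.Quotient.mk_eq_zero, ← Submodule.mkQ_apply, map_sum, ← θ.symm.sum_comp,
        Fintype.sum_sum_type] at hc
      have h2 (i) : S.mkQ (g (a i)) = 0 := (Submodule.Quotient.mk_eq_zero _).2 (f i).2
      simpa [h2, e] using hc
    intro r j hr
    rcases hθ : θ r with i | j'
    · simp [hθ] at hr
    · rw [← θ.symm_apply_apply r, hθ]
      exact Fintype.linearIndependent_iff.1 hbli _ h1 j'

theorem eq_zero_of_linear_ode {κ : Type*} [Fintype κ] {Q Q' : ℝ → κ → ℝ} {m : κ → κ → ℝ → ℝ}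
    (hm : ∀ i j, ContinuousOn (m i j) (Set.Icc 0 1))
    (hQ : ∀ t ∈ Set.Icc (0 : ℝ) 1, HasDerivAt Q (Q' t) t)
    (hQ' : ∀ t ∈ Set.Icc (0 : ℝ) 1, ∀ i, Q' t i = ∑ j, m i j t * Q t j) (h0 : Q 0 = 0) :
    ∀ t ∈ Set.Icc (0 : ℝ) 1, Q t = 0 := by
  have hbd (i j) : ∃ C, ∀ t ∈ Set.Icc (0 : ℝ) 1, ‖m i j t‖ ≤ C :=
    isCompact_Icc.exists_bound_of_continuousOn (hm i j)
  choose C hC using hbd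
  have hC0 (i j) : 0 ≤ C i j := (norm_nonneg _).trans (hC i j 0 (by simp))
  have := norm_le_gronwallBound_of_norm_deriv_right_le (f := Q) (f' := Q') (δ := 0)
    (K := ∑ i, ∑ j, C i j) (ε := 0) (a := 0) (b := 1)
    (fun t ht => (hQ t ht).continuousAt.continuousWithinAt)
    (fun t ht => (hQ t ⟨ht.1, ht.2.le⟩).hasDerivWithinAt) (by simp [h0]) (fun t ht => ?_)
  · intro t ht
    simpa [gronwallBound_ε0_δ0] using this t ht
  · have ht' : t ∈ Set.Icc (0 : ℝ) 1 := ⟨ht.1, ht.2.le⟩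
    rw [add_zero, pi_norm_le_iff_of_nonneg (mul_nonneg
      (Finset.sum_nonneg fun i _ => Finset.sum_nonneg fun j _ => hC0 i j) (norm_nonneg _))]
    intro i
    rw [hQ' t ht']
    calc ‖∑ j, m i j t * Q t j‖ ≤ ∑ j, C i j * ‖Q t‖ := by
          refine (norm_sum_le _ _).trans (Finset.sum_le_sum fun j _ => ?_)
          rw [norm_mul]
          exact mul_le_mul (hC i j t ht') (norm_le_pi_norm _ j) (norm_nonneg _) (hC0 i j)
      _ = (∑ j, C i j) * ‖Q t‖ := by rw [Finset.sum_mul]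
      _ ≤ (∑ i, ∑ j, C i j) * ‖Q t‖ := by
          refine mul_le_mul_of_nonneg_right ?_ (norm_nonneg _)
          exact Finset.single_le_sum (f := fun i => ∑ j, C i j)
            (fun i _ => Finset.sum_nonneg fun j _ => hC0 i j) (Finset.mem_univ i)

open MvPolynomial in
theorem MvPolynomial.hasFDerivAt_aeval {σ : Type*} [Fintype σ] (p : MvPolynomial σ ℚ) (v : σ → ℝ) :
    HasFDerivAt (fun v : σ → ℝ => aeval v p)
      (∑ s, aeval v (pderiv s p) •
        ContinuousLinearMap.proj (R := ℝ) (φ := fun _ : σ => ℝ) s) v := by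
  classical
  induction p using MvPolynomial.induction_on with
  | C a => simpa using hasFDerivAt_const (a : ℝ) v
  | add p q hp hq => simpa [add_smul, Finset.sum_add_distrib] using hp.fun_add hq
  | mul_X p i hp =>
    have h := hp.mul (hasFDerivAt_apply (𝕜 := ℝ) (F' := fun _ : σ => ℝ) i v)
    simp only [map_mul, aeval_X]
    refine h.congr_fderiv ?_
    ext w
    simp only [Derivation.leibniz, pderiv_X]
    have h1 (s : σ) : aeval v (Pi.single (M := fun _ => MvPolynomial σ ℚ) s 1 i) =
        if i = s then (1 : ℝ) else 0 := by
      rw [Pi.single_apply]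
      split_ifs <;> simp
    simp [h1, add_mul, Finset.sum_add_distrib, Finset.mul_sum, mul_assoc]

theorem MvPolynomial.contDiff_aeval {σ : Type*} [Fintype σ] (p : MvPolynomial σ ℚ) :
    ContDiff ℝ 1 fun v : σ → ℝ => MvPolynomial.aeval v p := by
  induction p using MvPolynomial.induction_on with
  | C a => simpa using contDiff_const
  | add p q hp hq => simpa using hp.add hq
  | mul_X p i hp => simpa using hp.mul (contDiff_apply ℝ ℝ i)

section System

open MvPolynomial

variable {σ κ : Type*} [Fintype σ] [DecidableEq σ] [Fintype κ]

theorem exists_det_mul_eq {v₀ : σ → ℝ} {F : κ → (σ → ℝ) → ℝ} {g : κ → σ → MvPolynomial σ ℚ}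
    {ρ : κ → κ → (σ → ℝ) → ℝ} (hρ : ∀ k k', Continuous (ρ k k'))
    (hfd : ∀ k v w, fderiv ℝ (F k) v w = ∑ s, aeval v (g k s) * w s + ∑ k', ρ k k' w * F k' v)
    (hP : ∀ p : MvPolynomial σ ℚ, aeval v₀ p = 0 →
      ∃ c : κ → MvPolynomial σ ℚ, ∀ v, aeval v p = ∑ k, aeval v (c k) * F k v)
    {h : σ → κ ⊕ σ} {M : Matrix σ σ (MvPolynomial σ ℚ)}
    (hM : M = Matrix.of fun r => Sum.elim g (fun j => Pi.single j 1) (h r))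
    (hinr : ∀ c : σ → ℝ, ∑ r, c r • Sum.elim (fun k s => aeval v₀ (g k s))
      (fun j => Pi.single j 1) (h r) ∈ Submodule.span ℝ (Set.range fun k s => aeval v₀ (g k s)) →
      ∀ r j, h r = .inr j → c r = 0)
    (W : σ → MvPolynomial σ ℚ)
    (hW : (fun s => aeval v₀ (W s)) ∈ Submodule.span ℝ (Set.range fun k s => aeval v₀ (g k s))) :
    ∃ m : κ → (σ → ℝ) → (σ → ℝ) → ℝ,
      (∀ k, Continuous fun p : (σ → ℝ) × (σ → ℝ) => m k p.1 p.2) ∧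
      ∀ v w, (∀ r k, h r = .inl k → fderiv ℝ (F k) v w = 0) →
        aeval v M.det * ∑ s, aeval v (W s) * w s = ∑ k, m k v w * F k v := by
  let c := Matrix.vecMul W M.adjugate
  have hc (s : σ) : ∑ r, c r * M r s = M.det * W s := by
    have : Matrix.vecMul c M = M.det • W := by
      rw [Matrix.vecMul_vecMul, Matrix.adjugate_mul, Matrix.vecMul_smul, Matrix.vecMul_one]
    exact congrFun this s
  have hC : ∀ r, ∃ C : κ → MvPolynomial σ ℚ, ∀ j, h r = .inr j →
      ∀ v, aeval v (c r) = ∑ k, aeval v (C k) * F k v := by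
    intro r
    rcases hr : h r with k | j
    · exact ⟨0, by simp⟩
    · have h0 : aeval v₀ (c r) = 0 := by
        refine hinr (fun r => aeval v₀ (c r)) ?_ r j hr
        convert Submodule.smul_mem _ (aeval v₀ M.det) hW using 1
        ext s
        have := congrArg (aeval v₀) (hc s)
        simp only [map_sum, map_mul] at this
        simp only [Finset.sum_apply, Pi.smul_apply, smul_eq_mul, ← this]
        refine Finset.sum_congr rfl fun r _ => ?_
        rw [hM, Matrix.of_apply]
        rcases h r with k | j
        · rfl
        · by_cases hj : j = s
          · subst hj
            simp
          · simp [Ne.symm hj]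
      obtain ⟨C, hC⟩ := hP _ h0
      exact ⟨C, fun _ _ => hC⟩
  choose C hC using hC
  refine ⟨fun k v w => ∑ r, Sum.elim (fun k₀ => - aeval v (c r) * ρ k₀ k w)
    (fun j => aeval v (C r k) * w j) (h r), fun k => ?_, fun v w hvw => ?_⟩
  · refine continuous_finsetSum _ fun r _ => ?_
    rcases h r with k₀ | j
    · have h1 := (c r).contDiff_aeval.continuous
      have h2 := hρ k₀ k
      simp only [Sum.elim_inl]
      fun_prop
    · have h1 := (C r k).contDiff_aeval.continuous
      simp only [Sum.elim_inr]
      fun_prop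
  · have h1 (r : σ) : aeval v (c r) * ∑ s, aeval v (M r s) * w s =
        ∑ k, Sum.elim (fun k₀ => - aeval v (c r) * ρ k₀ k w)
          (fun j => aeval v (C r k) * w j) (h r) * F k v := by
      rcases hr : h r with k₀ | j
      · have h2 := hvw r k₀ hr
        rw [hfd, add_eq_zero_iff_eq_neg] at h2
        have h3 : ∑ s, aeval v (M r s) * w s = -∑ k', ρ k₀ k' w * F k' v := by
          rw [← h2]
          simp [hM, hr]
        simp only [h3, Sum.elim_inl, neg_mul, mul_neg, Finset.sum_neg_distrib, Finset.mul_sum,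
          mul_assoc]
      · have h3 : ∑ s, aeval v (M r s) * w s = w j := by
          simp [hM, hr, Pi.single_apply, apply_ite (aeval v)]
        rw [h3, hC r j hr, Finset.sum_mul]
        refine Finset.sum_congr rfl fun k _ => ?_
        simp only [Sum.elim_inr]
        ring
    simp only [Finset.sum_mul]
    rw [Finset.sum_comm, ← Finset.sum_congr rfl fun r _ => h1 r]
    simp only [Finset.mul_sum]
    rw [Finset.sum_comm]
    refine Finset.sum_congr rfl fun s _ => ?_
    rw [← mul_assoc, ← map_mul, ← hc, map_sum, Finset.sum_mul]
    refine Finset.sum_congr rfl fun r _ => ?_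
    rw [map_mul]
    ring

end System

section System

open MvPolynomial Filter Topology

variable {σ κ : Type*} [Fintype σ] [DecidableEq σ] [Fintype κ]

/-- If a coordinate is infinitesimally determined by the system `F = 0` at `v₀`, then it takes the
same value at a regular point of a system made of equations `F k = 0` and `v j = q` with `q`
rational. The hypotheses say that, up to combinations of the `F k` themselves, the differentials of
the `F k` have polynomial entries `g k s`, and that `v₀` is generic among the zeros of `F`. -/
theorem exists_regular_point {v₀ : σ → ℝ} {F : κ → (σ → ℝ) → ℝ} {g : κ → σ → MvPolynomial σ ℚ}
    {ρ : κ → κ → (σ → ℝ) → ℝ} (hF : ∀ k, ContDiff ℝ 1 (F k)) (hF₀ : ∀ k, F k v₀ = 0)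
    (hρ : ∀ k k', Continuous (ρ k k'))
    (hfd : ∀ k v w, fderiv ℝ (F k) v w = ∑ s, aeval v (g k s) * w s + ∑ k', ρ k k' w * F k' v)
    (hP : ∀ p : MvPolynomial σ ℚ, aeval v₀ p = 0 →
      ∃ c : κ → MvPolynomial σ ℚ, ∀ v, aeval v p = ∑ k, aeval v (c k) * F k v)
    (s₀ : σ) (hs₀ : Pi.single s₀ 1 ∈ Submodule.span ℝ (Set.range fun k s => aeval v₀ (g k s))) :
    ∃ v₁ : σ → ℝ, v₁ s₀ = v₀ s₀ ∧ (∀ k, F k v₁ = 0) ∧ ∃ (h : σ → κ ⊕ σ) (q : σ → ℚ),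
      (∀ r j, h r = .inr j → v₁ j = q r) ∧
      (Matrix.of fun r => Sum.elim (fun k s => aeval v₁ (g k s))
        (fun j => Pi.single j 1) (h r)).det ≠ 0 := by
  obtain ⟨h, hdet₀, hinr⟩ := exists_det_ne_zero_of_rows fun k s => aeval v₀ (g k s)
  obtain ⟨M, hM⟩ : ∃ M : Matrix σ σ (MvPolynomial σ ℚ),
    M = Matrix.of fun r => Sum.elim g (fun j => Pi.single j 1) (h r) := ⟨_, rfl⟩
  have hMv (v : σ → ℝ) : (aeval v).mapMatrix M = Matrix.of fun r =>
      Sum.elim (fun k s => aeval v (g k s)) (fun j => Pi.single j 1) (h r) := by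
    ext r s
    rw [hM]
    rcases hr : h r with k | j
    · simp [hr]
    · by_cases hj : s = j
      · subst hj
        simp [hr]
      · simp [hr, hj]
  have hdet (v : σ → ℝ) : aeval v M.det = (Matrix.of fun r =>
      Sum.elim (fun k s => aeval v (g k s)) (fun j => Pi.single j 1) (h r)).det := by
    rw [← hMv, AlgHom.map_det]
  rw [← hdet] at hdet₀
  let Φ (v : σ → ℝ) (r : σ) : ℝ := Sum.elim (fun k => F k v) v (h r)
  have hΦ : ContDiff ℝ 1 Φ := by
    refine contDiff_pi.2 fun r => ?_
    simp only [Φ]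
    rcases h r with k | j
    · exact hF k
    · exact contDiff_apply ℝ ℝ j
  have hΦ' (v w : σ → ℝ) (r : σ) :
      fderiv ℝ Φ v w r = Sum.elim (fun k => fderiv ℝ (F k) v w) w (h r) := by
    have h1 := hasFDerivAt_pi'.1 ((hΦ.differentiable one_ne_zero) v).hasFDerivAt r
    have h2 := h1.fderiv
    have h3 : fderiv ℝ Φ v w r = fderiv ℝ (fun v => Φ v r) v w := by rw [h2]; rfl
    rw [h3]
    simp only [Φ]
    rcases h r with k | j
    · rfl
    · exact congrArg (· w) (hasFDerivAt_apply (𝕜 := ℝ) (F' := fun _ : σ => ℝ) j v).fderiv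
  have hinj : Function.Injective (fderiv ℝ Φ v₀) := by
    rw [injective_iff_map_eq_zero]
    intro w hw
    refine Matrix.eq_zero_of_mulVec_eq_zero (hdet v₀ ▸ hdet₀) (funext fun r => ?_)
    have h1 := congrFun hw r
    rw [hΦ'] at h1
    simp only [Matrix.mulVec, dotProduct, Matrix.of_apply, Pi.zero_apply] at h1 ⊢
    rcases hr : h r with k | j
    · simpa [hr, hfd, hF₀] using h1
    · simpa [hr, Pi.single_apply] using h1
  let e : (σ → ℝ) ≃L[ℝ] (σ → ℝ) :=
    (LinearEquiv.ofInjectiveEndo (fderiv ℝ Φ v₀ : (σ → ℝ) →ₗ[ℝ] (σ → ℝ))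
      hinj).toContinuousLinearEquiv
  have he : HasFDerivAt Φ (e : (σ → ℝ) →L[ℝ] (σ → ℝ)) v₀ :=
    ((hΦ.differentiable one_ne_zero) v₀).hasFDerivAt.congr_fderiv (by ext1 w; rfl)
  let ψ := (hΦ.contDiffAt (x := v₀)).localInverse he one_ne_zero
  have hψ : ContDiffAt ℝ 1 ψ (Φ v₀) := hΦ.contDiffAt.to_localInverse he one_ne_zero
  have hψ₀ : ψ (Φ v₀) = v₀ := ContDiffAt.localInverse_apply_image _ _ _
  have hev : ∀ᶠ y in 𝓝 (Φ v₀), ContDiffAt ℝ 1 ψ y ∧ Φ (ψ y) = y ∧ aeval (ψ y) M.det ≠ 0 := by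
    refine (hψ.eventually (by simp)).and (HasStrictFDerivAt.eventually_right_inverse _ |>.and ?_)
    have h1 : ContinuousAt (fun y => aeval (ψ y) M.det) (Φ v₀) :=
      M.det.contDiff_aeval.continuous.continuousAt.comp hψ.continuousAt
    exact h1.eventually_ne (by rwa [hψ₀])
  obtain ⟨ε, hε, hball⟩ := Metric.eventually_nhds_iff_ball.1 hev
  choose q hq using fun r => exists_rat_near (Φ v₀ r) (half_pos hε)
  let y₁ (r : σ) : ℝ := Sum.elim (fun _ => 0) (fun _ => (q r : ℝ)) (h r)
  have hy₁ : ‖y₁ - Φ v₀‖ < ε := by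
    refine lt_of_le_of_lt ((pi_norm_le_iff_of_nonneg (half_pos hε).le).2 fun r => ?_)
      (half_lt_self hε)
    rcases hr : h r with k | j
    · simpa [y₁, Φ, hr, hF₀] using (half_pos hε).le
    · rw [Pi.sub_apply, norm_sub_rev]
      simpa [y₁, hr] using (hq r).le
  let y (t : ℝ) : σ → ℝ := Φ v₀ + t • (y₁ - Φ v₀)
  have hy (t : ℝ) (ht : t ∈ Set.Icc (0 : ℝ) 1) : y t ∈ Metric.ball (Φ v₀) ε := by
    rw [mem_ball_iff_norm]
    simp only [y, add_sub_cancel_left, norm_smul, Real.norm_of_nonneg ht.1]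
    exact (mul_le_of_le_one_left (norm_nonneg _) ht.2).trans_lt hy₁
  let γ (t : ℝ) := ψ (y t)
  let w (t : ℝ) := fderiv ℝ ψ (y t) (y₁ - Φ v₀)
  have hγ (t : ℝ) (ht : t ∈ Set.Icc (0 : ℝ) 1) : HasDerivAt γ (w t) t := by
    have h1 := ((hball _ (hy t ht)).1.differentiableAt one_ne_zero).hasFDerivAt
    have h2 : HasDerivAt y (y₁ - Φ v₀) t := by
      simpa [y] using ((hasDerivAt_id t).smul_const (y₁ - Φ v₀)).const_add (Φ v₀)
    exact h1.comp_hasDerivAt t h2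
  have hγc : ContinuousOn γ (Set.Icc 0 1) := fun t ht => (hγ t ht).continuousAt.continuousWithinAt
  have hwc : ContinuousOn w (Set.Icc 0 1) := by
    intro t ht
    have h1 : ContinuousAt (fderiv ℝ ψ) (y t) :=
      ((hball _ (hy t ht)).1.fderiv_right (m := 0) (by simp)).continuousAt
    have h2 : Continuous y := by fun_prop
    exact ((h1.comp h2.continuousAt).clm_apply continuousAt_const).continuousWithinAt
  have hΦγ (t : ℝ) (ht : t ∈ Set.Icc (0 : ℝ) 1) : Φ (γ t) = y t := (hball _ (hy t ht)).2.1
  have htan (t : ℝ) (ht : t ∈ Set.Icc (0 : ℝ) 1) (r : σ) (k : κ) (hr : h r = .inl k) :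
      fderiv ℝ (F k) (γ t) (w t) = 0 := by
    have h1 : fderiv ℝ Φ (γ t) (w t) = y₁ - Φ v₀ := by
      have h2 : HasFDerivAt (Φ ∘ ψ) _ (y t) :=
        ((hΦ.differentiable one_ne_zero) _).hasFDerivAt.comp (y t)
          ((hball _ (hy t ht)).1.differentiableAt one_ne_zero).hasFDerivAt
      have h3 : HasFDerivAt (Φ ∘ ψ) (ContinuousLinearMap.id ℝ (σ → ℝ)) (y t) := by
        refine (hasFDerivAt_id (y t)).congr_of_eventuallyEq ?_
        filter_upwards [Metric.isOpen_ball.mem_nhds (hy t ht)] with z hz using (hball z hz).2.1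
      exact congrArg (· (y₁ - Φ v₀)) (h2.unique h3)
    have h2 := congrFun h1 r
    rw [hΦ'] at h2
    simpa [hr, y₁, Φ, hF₀] using h2
  have hkey := exists_det_mul_eq hρ hfd hP hM hinr
  choose m hm hm' using fun k => hkey (g k) (Submodule.subset_span ⟨k, rfl⟩)
  have hzero : ∀ t ∈ Set.Icc (0 : ℝ) 1, (fun k => F k (γ t)) = 0 := by
    refine eq_zero_of_linear_ode (Q := fun t k => F k (γ t))
      (Q' := fun t k => fderiv ℝ (F k) (γ t) (w t))
      (m := fun k k' t => (aeval (γ t) M.det)⁻¹ * m k k' (γ t) (w t) + ρ k k' (w t)) ?_ ?_ ?_ ?_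
    · intro k k'
      have h1 : ContinuousOn (fun t => aeval (γ t) M.det) (Set.Icc 0 1) :=
        M.det.contDiff_aeval.continuous.comp_continuousOn hγc
      have h2 : ContinuousOn (fun t => m k k' (γ t) (w t)) (Set.Icc 0 1) :=
        (hm k k').comp_continuousOn (hγc.prodMk hwc)
      exact ((h1.inv₀ fun t ht => (hball _ (hy t ht)).2.2).mul h2).add
        ((hρ k k').comp_continuousOn hwc)
    · exact fun t ht => hasDerivAt_pi.2 fun k =>
        (((hF k).differentiable one_ne_zero) _).hasFDerivAt.comp_hasDerivAt t (hγ t ht)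
    · intro t ht k
      have h1 := hm' k (γ t) (w t) (htan t ht)
      have h2 : aeval (γ t) M.det ≠ 0 := (hball _ (hy t ht)).2.2
      simp only [add_mul, Finset.sum_add_distrib, mul_assoc, ← Finset.mul_sum, ← h1]
      rw [inv_mul_cancel_left₀ h2, hfd]
    · ext k
      simp [γ, y, hψ₀, hF₀]
  have hconst : γ 1 s₀ = γ 0 s₀ := by
    refine constant_of_has_deriv_right_zero (f := fun t => γ t s₀) (a := 0) (b := 1)
      (fun t ht => (hasDerivAt_pi.1 (hγ t ht) s₀).continuousAt.continuousWithinAt)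
      (fun t ht => ?_) 1 (by simp)
    have ht' : t ∈ Set.Icc (0 : ℝ) 1 := ⟨ht.1, ht.2.le⟩
    obtain ⟨m₀, -, hm₀⟩ := hkey (Pi.single s₀ 1) (by
      convert hs₀ using 1
      ext s
      by_cases hs : s = s₀
      · subst hs
        simp
      · simp [hs])
    have h1 := hm₀ (γ t) (w t) (htan t ht')
    have h2 : aeval (γ t) M.det ≠ 0 := (hball _ (hy t ht')).2.2
    have h3 (k) : F k (γ t) = 0 := congrFun (hzero t ht') k
    have h4 : w t s₀ = 0 := by
      simpa [h3, h2, Pi.single_apply, apply_ite (aeval (γ t))] using h1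
    exact h4 ▸ (hasDerivAt_pi.1 (hγ t ht') s₀).hasDerivWithinAt
  have h1 : (1 : ℝ) ∈ Set.Icc (0 : ℝ) 1 := by simp
  refine ⟨γ 1, by rw [hconst]; simp [γ, y, hψ₀], fun k => congrFun (hzero 1 h1) k, h, q,
    fun r j hr => ?_, ?_⟩
  · have := congrFun (hΦγ 1 h1) r
    simpa [Φ, hr, y, y₁] using this
  · rw [← hdet]
    exact (hball _ (hy 1 h1)).2.2

end System

theorem Algebra.FormallySmooth.of_injective_charZero (R L : Type*) [CommRing R] [IsDomain R]
    [CharZero R] [Field L] [Algebra R L] [FaithfulSMul R L] : Algebra.FormallySmooth R L := by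
  let := FractionRing.liftAlgebra R L
  have := Algebra.FormallySmooth.of_isLocalization (R := R) (Rₘ := FractionRing R)
    (nonZeroDivisors R)
  have := Algebra.FormallySmooth.of_charZero (FractionRing R) L
  exact .comp R (FractionRing R) L

open MvPolynomial in
theorem exists_derivation_apply_eq {σ : Type*} [Fintype σ] (v w : σ → ℝ)
    (h : ∀ p : MvPolynomial σ ℚ, aeval v p = 0 → ∑ s, aeval v (pderiv s p) * w s = 0) :
    ∃ δ : Derivation ℚ ℝ ℝ, ∀ s, δ (v s) = w s := by
  classical
  let f : MvPolynomial σ ℚ →ₐ[ℚ] ℝ := aeval v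
  let E : MvPolynomial σ ℚ →ₗ[ℚ] ℝ := ∑ s, w s • f.toLinearMap ∘ₗ (pderiv s).toLinearMap
  have hE (p) : E p = ∑ s, w s * aeval v (pderiv s p) := by
    simp [E, f]
  let π : MvPolynomial σ ℚ →ₗ[ℚ] f.range := f.rangeRestrict.toLinearMap
  have hπ : Function.Surjective π := f.rangeRestrict_surjective
  have hker : LinearMap.ker π ≤ LinearMap.ker E := fun p hp => by
    rw [LinearMap.mem_ker, hE]
    simpa only [mul_comm] using h p (congrArg Subtype.val hp)
  let D₀ : f.range →ₗ[ℚ] ℝ :=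
    (LinearMap.ker π).liftQ E hker ∘ₗ (π.quotKerEquivOfSurjective hπ).symm.toLinearMap
  have hD₀ (p) : D₀ (π p) = E p := by
    have : (π.quotKerEquivOfSurjective hπ).symm (π p) = Submodule.Quotient.mk p :=
      (LinearEquiv.symm_apply_eq _).2 rfl
    simp only [D₀, LinearMap.comp_apply, LinearEquiv.coe_coe, this]
    simp
  let D : Derivation ℚ f.range ℝ := Derivation.mk' D₀ fun a b => by
    obtain ⟨p, rfl⟩ := hπ a
    obtain ⟨q, rfl⟩ := hπ b
    have h1 : π p * π q = π (p * q) := (map_mul f.rangeRestrict p q).symm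
    rw [h1]
    simp only [hD₀, hE]
    have h2 (p) (x : ℝ) : π p • x = aeval v p * x := rfl
    simp only [h2, Derivation.leibniz, map_add, smul_eq_mul, map_mul, mul_add,
      Finset.sum_add_distrib, Finset.mul_sum]
    congr 1 <;> exact Finset.sum_congr rfl fun s _ => by ring
  have : Algebra.FormallySmooth f.range ℝ := .of_injective_charZero _ _
  obtain ⟨δ, hδ⟩ := D.exists_extension
  refine ⟨δ, fun s => ?_⟩
  have h1 : algebraMap f.range ℝ (π (X s)) = v s := aeval_X v s
  rw [← h1, hδ]
  change D₀ (π (X s)) = w s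
  rw [hD₀, hE]
  have h2 (i : σ) : aeval v (Pi.single (M := fun _ => MvPolynomial σ ℚ) i 1 s) =
      if s = i then (1 : ℝ) else 0 := by
    rw [Pi.single_apply]
    split_ifs <;> simp
  simp [pderiv_X, h2]

open MvPolynomial in
theorem MvPolynomial.exists_int_multiple {τ : Type*} (p : MvPolynomial τ ℚ) :
    ∃ (N : ℤ) (P : MvPolynomial τ ℤ), N ≠ 0 ∧ map (Int.castRingHom ℚ) P = C (N : ℚ) * p := by
  induction p using MvPolynomial.induction_on with
  | C a =>
    refine ⟨a.den, C a.num, by exact_mod_cast a.den_nz, ?_⟩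
    rw [map_C, ← C_mul]
    congr 1
    simp [mul_comm, Rat.mul_den_eq_num]
  | add p q hp hq =>
    obtain ⟨N, P, hN, hP⟩ := hp
    obtain ⟨N', Q, hN', hQ⟩ := hq
    refine ⟨N * N', C N' * P + C N * Q, mul_ne_zero hN hN', ?_⟩
    simp only [map_add, map_mul, map_C, hP, hQ, Int.cast_mul]
    simp only [eq_intCast]
    ring
  | mul_X p i hp =>
    obtain ⟨N, P, hN, hP⟩ := hp
    exact ⟨N, P * X i, hN, by rw [map_mul, map_X, hP, mul_assoc]⟩

open MvPolynomial in
theorem isExpAlgebraic_of_rat {n : ℕ} (xs : Fin (n + 1) → ℝ)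
    (f : Fin (n + 1) → MvPolynomial (Fin (n + 1) ⊕ Fin (n + 1)) ℚ)
    (hf : ∀ i, aeval (Sum.elim xs fun j => Real.exp (xs j)) (f i) = 0)
    (hdet : (Matrix.of fun i j =>
      aeval (Sum.elim xs fun j => Real.exp (xs j)) (pderiv (Sum.inl j) (f i)) + Real.exp (xs j) *
        aeval (Sum.elim xs fun j => Real.exp (xs j)) (pderiv (Sum.inr j) (f i))).det ≠ 0) :
    IsExpAlgebraic (xs 0) := by
  choose N P hN hP using fun i => (f i).exists_int_multiple
  have hev (x : Fin (n + 1) ⊕ Fin (n + 1) → ℝ) (Q : MvPolynomial (Fin (n + 1) ⊕ Fin (n + 1)) ℤ) :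
      eval x (map (Int.castRingHom ℝ) Q) = aeval x (map (Int.castRingHom ℚ) Q) := by
    rw [eval_map, aeval_def, eval₂_map]
    congr 1
  refine ⟨n + 1, n.succ_pos, xs, fun i => map (Int.castRingHom ℝ) (P i), rfl, fun i m => ?_,
    fun i => ?_, ?_⟩
  · rw [coeff_map, eq_intCast]
    exact intCast_mem _ _
  · rw [hev, hP, map_mul, hf, mul_zero]
  · have h1 := Matrix.det_mul_column (fun i => (N i : ℝ)) (Matrix.of fun i j =>
      aeval (Sum.elim xs fun j => Real.exp (xs j)) (pderiv (Sum.inl j) (f i)) + Real.exp (xs j) *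
        aeval (Sum.elim xs fun j => Real.exp (xs j)) (pderiv (Sum.inr j) (f i)))
    have h2 : (∏ i, (N i : ℝ)) ≠ 0 :=
      Finset.prod_ne_zero_iff.2 fun i _ => Int.cast_ne_zero.2 (hN i)
    convert h1 ▸ mul_ne_zero h2 hdet using 3
    ext i j
    simp only [Matrix.of_apply, pderiv_map, hev]
    rw [← pderiv_map, ← pderiv_map, hP, pderiv_C_mul, pderiv_C_mul, map_mul, map_mul, aeval_C]
    simp only [map_intCast]
    ring

open MvPolynomial in
theorem pderiv_inr_rename_inl {σ τ R : Type*} [CommSemiring R] (p : MvPolynomial σ R) (j : τ) :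
    pderiv (Sum.inr j) (rename (Sum.inl : σ → σ ⊕ τ) p) = 0 := by
  classical
  induction p using MvPolynomial.induction_on with
  | C a => simp
  | add p q hp hq => simp [hp, hq]
  | mul_X p i hp => simp [hp, pderiv_X]

open MvPolynomial in
theorem isExpAlgebraic_apply_zero {m : ℕ} {τ : Type*} [Fintype τ] (v₀ : Fin (m + 1) → ℝ)
    (sx sy : τ → Fin (m + 1)) (hexp : ∀ i, v₀ (sy i) = Real.exp (v₀ (sx i)))
    (h : ∀ δ : Derivation ℚ ℝ ℝ,
      (∀ i, δ (Real.exp (v₀ (sx i))) = Real.exp (v₀ (sx i)) * δ (v₀ (sx i))) → δ (v₀ 0) = 0) :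
    IsExpAlgebraic (v₀ 0) := by
  classical
  obtain ⟨S, hS⟩ : (RingHom.ker (aeval (R := ℚ) v₀)).FG := IsNoetherian.noetherian _
  have hSmem (q : S) : aeval v₀ (q : MvPolynomial (Fin (m + 1)) ℚ) = 0 := by
    rw [← RingHom.mem_ker, ← hS]
    exact Ideal.subset_span q.2
  have hspan {p : MvPolynomial (Fin (m + 1)) ℚ} (hp : aeval v₀ p = 0) :
      p ∈ Ideal.span (Set.range ((↑) : S → MvPolynomial (Fin (m + 1)) ℚ)) := by
    rw [Subtype.range_coe_subtype, Finset.setOfPred_mem]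
    exact hS.symm.le hp
  let F : S ⊕ τ → (Fin (m + 1) → ℝ) → ℝ :=
    Sum.elim (fun q v => aeval v (q : MvPolynomial (Fin (m + 1)) ℚ))
      fun i v => v (sy i) - Real.exp (v (sx i))
  let g : S ⊕ τ → Fin (m + 1) → MvPolynomial (Fin (m + 1)) ℚ :=
    Sum.elim (fun q s => pderiv s (q : MvPolynomial (Fin (m + 1)) ℚ))
      fun i s => Pi.single (M := fun _ => MvPolynomial (Fin (m + 1)) ℚ) (sy i) 1 s -
        X (sy i) * Pi.single (M := fun _ => MvPolynomial (Fin (m + 1)) ℚ) (sx i) 1 s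
  let ρ : S ⊕ τ → S ⊕ τ → (Fin (m + 1) → ℝ) → ℝ :=
    Sum.elim (fun _ _ _ => 0) fun i => Sum.elim (fun _ _ => 0) fun i' w =>
      if i = i' then w (sx i) else 0
  have hsingle (v : Fin (m + 1) → ℝ) (j s : Fin (m + 1)) :
      aeval v (Pi.single (M := fun _ => MvPolynomial (Fin (m + 1)) ℚ) j 1 s) =
        Pi.single (M := fun _ => ℝ) j 1 s := by
    rw [Pi.single_apply, Pi.single_apply]
    split_ifs <;> simp
  have hgr (v : Fin (m + 1) → ℝ) (i : τ) (s) : aeval v (g (.inr i) s) =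
      Pi.single (M := fun _ => ℝ) (sy i) 1 s -
        v (sy i) * Pi.single (M := fun _ => ℝ) (sx i) 1 s := by
    simp only [g, Sum.elim_inr, map_sub, map_mul, aeval_X, hsingle]
  have hsum (w : Fin (m + 1) → ℝ) (j : Fin (m + 1)) :
      ∑ s, Pi.single (M := fun _ => ℝ) j 1 s * w s = w j := by
    simp [Pi.single_apply]
  have hgsum (v w : Fin (m + 1) → ℝ) (i : τ) :
      ∑ s, aeval v (g (.inr i) s) * w s = w (sy i) - v (sy i) * w (sx i) := by
    simp only [hgr, sub_mul, Finset.sum_sub_distrib, mul_assoc, ← Finset.mul_sum, hsum]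
  have hF (k) : ContDiff ℝ 1 (F k) := by
    rcases k with (q | i)
    · exact MvPolynomial.contDiff_aeval _
    · change ContDiff ℝ 1 fun v : Fin (m + 1) → ℝ => v (sy i) - Real.exp (v (sx i))
      fun_prop
  have hF₀ (k) : F k v₀ = 0 := by
    rcases k with (q | i)
    · exact hSmem q
    · exact sub_eq_zero.2 (hexp i)
  have hρ (k k') : Continuous (ρ k k') := by
    rcases k with (q | i) <;> rcases k' with (q' | i')
    · exact continuous_const
    · exact continuous_const
    · exact continuous_const
    · change Continuous fun w : Fin (m + 1) → ℝ => if i = i' then w (sx i) else 0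
      split_ifs <;> fun_prop
  have hfd (k v w) : fderiv ℝ (F k) v w =
      ∑ s, aeval v (g k s) * w s + ∑ k', ρ k k' w * F k' v := by
    rcases k with (q | i)
    · have h1 : HasFDerivAt (F (.inl q)) _ v :=
        MvPolynomial.hasFDerivAt_aeval (q : MvPolynomial (Fin (m + 1)) ℚ) v
      rw [h1.fderiv]
      simp [g, ρ]
    · have h1 : HasFDerivAt (F (.inr i)) (ContinuousLinearMap.proj (R := ℝ)
          (φ := fun _ : Fin (m + 1) => ℝ) (sy i) - Real.exp (v (sx i)) •
          ContinuousLinearMap.proj (R := ℝ) (φ := fun _ : Fin (m + 1) => ℝ) (sx i)) v :=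
        (hasFDerivAt_apply (sy i) v).sub (hasFDerivAt_apply (sx i) v).exp
      rw [h1.fderiv, hgsum]
      simp [F, ρ]
      ring
  have hP (p : MvPolynomial (Fin (m + 1)) ℚ) (hp : aeval v₀ p = 0) :
      ∃ c : S ⊕ τ → MvPolynomial (Fin (m + 1)) ℚ, ∀ v, aeval v p = ∑ k, aeval v (c k) * F k v := by
    obtain ⟨c, rfl⟩ := Ideal.mem_span_range_iff_exists_fun.1 (hspan hp)
    exact ⟨Sum.elim c 0, fun v => by simp [F]⟩
  have hs : Pi.single 0 1 ∈ Submodule.span ℝ (Set.range fun k s => aeval v₀ (g k s)) := by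
    by_contra hns
    obtain ⟨f, hf0, hf⟩ := Submodule.exists_le_ker_of_notMem hns
    have hfw (w : Fin (m + 1) → ℝ) : f w = ∑ s, w s * f (Pi.single s 1) := by
      conv_lhs => rw [pi_eq_sum_univ' w]
      simp
    have hfg (k) : ∑ s, aeval v₀ (g k s) * f (Pi.single s 1) = 0 := by
      rw [← hfw]
      exact hf (Submodule.subset_span ⟨k, rfl⟩)
    obtain ⟨δ, hδ⟩ := exists_derivation_apply_eq v₀ (fun s => f (Pi.single s 1)) fun p hp => by
      obtain ⟨c, rfl⟩ := Ideal.mem_span_range_iff_exists_fun.1 (hspan hp)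
      simp only [map_sum, Derivation.leibniz, smul_eq_mul, map_add, map_mul, hSmem, zero_mul,
        add_zero, Finset.sum_mul]
      rw [Finset.sum_comm]
      refine Finset.sum_eq_zero fun q _ => ?_
      simp only [mul_assoc, ← Finset.mul_sum]
      exact mul_eq_zero_of_right _ (hfg (.inl q))
    refine hf0 ?_
    rw [← hδ]
    refine h δ fun i => ?_
    have h1 := hfg (.inr i)
    rw [hgsum] at h1
    rw [← hexp, hδ, hδ]
    exact sub_eq_zero.1 h1
  obtain ⟨v₁, hv0, hF1, hr, q, hq, hdet⟩ := exists_regular_point hF hF₀ hρ hfd hP 0 hs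
  rw [← hv0]
  let f (r : Fin (m + 1)) : MvPolynomial (Fin (m + 1) ⊕ Fin (m + 1)) ℚ :=
    Sum.elim (Sum.elim (fun q : S => rename .inl (q : MvPolynomial (Fin (m + 1)) ℚ))
      fun i => X (.inl (sy i)) - X (.inr (sx i))) (fun j => X (.inl j) - C (q r)) (hr r)
  refine isExpAlgebraic_of_rat v₁ f (fun r => ?_) ?_
  · rcases hk : hr r with (⟨p⟩ | i) | j
    · simpa [f, hk, aeval_rename, Function.comp_def] using
        show aeval v₁ (p : MvPolynomial (Fin (m + 1)) ℚ) = 0 from hF1 (.inl p)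
    · simpa [f, hk] using show v₁ (sy i) - Real.exp (v₁ (sx i)) = 0 from hF1 (.inr i)
    · simp [f, hk, hq r j hk]
  · convert hdet using 3
    ext r j
    rcases hk : hr r with (p | i) | j'
    · simp [f, hk, g, pderiv_rename Sum.inl_injective, aeval_rename, Function.comp_def,
        pderiv_inr_rename_inl]
    · have h1 : v₁ (sy i) = Real.exp (v₁ (sx i)) := sub_eq_zero.1 (hF1 (.inr i))
      simp only [f, hk, Sum.elim_inl, Sum.elim_inr, hgr, h1, map_sub, pderiv_X, Pi.single_apply,
        reduceCtorEq, if_false, Sum.inl.injEq, Sum.inr.injEq, eq_comm (a := j)]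
      by_cases h2 : sy i = j <;> by_cases h3 : sx i = j <;> simp [h2, h3, sub_eq_add_neg]
    · simp only [f, hk, Sum.elim_inr, map_sub, pderiv_X, Pi.single_apply, reduceCtorEq, if_false,
        Sum.inl.injEq, eq_comm (a := j)]
      split_ifs <;> simp

theorem isExpAlgebraic_of_derivation {l : ℝ} (T : Finset ℝ)
    (h : ∀ δ : Derivation ℚ ℝ ℝ, (∀ x ∈ T, δ (Real.exp x) = Real.exp x * δ x) → δ l = 0) :
    IsExpAlgebraic l := by
  let x (i : Fin T.card) : ℝ := T.equivFin.symm i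
  let v₀ : Fin (T.card + T.card + 1) → ℝ := Fin.cons l (Fin.append x fun i => Real.exp (x i))
  have hx (i : Fin T.card) : v₀ (i.castAdd T.card).succ = x i := by simp [v₀]
  refine isExpAlgebraic_apply_zero v₀ (fun i : Fin T.card => (i.castAdd T.card).succ)
    (fun i => (i.natAdd T.card).succ)
    (fun i => by simp only [v₀, Fin.cons_succ, Fin.append_left, Fin.append_right])
    fun δ hδ => h δ fun y hy => ?_
  have h1 : x (T.equivFin ⟨y, hy⟩) = y := by simp [x]
  simpa only [hx, h1] using hδ (T.equivFin ⟨y, hy⟩)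

theorem Derivation.exists_isExponential {l : ℝ} (hl : ¬ IsExpAlgebraic l) :
    ∃ d : Derivation ℚ ℝ ℝ, d.IsExponential ∧ d l = 1 := by
  let D := KaehlerDifferential.D ℚ ℝ
  let ω (x : ℝ) : KaehlerDifferential ℚ ℝ := D (Real.exp x) - Real.exp x • D x
  by_cases hmem : D l ∈ Submodule.span ℝ (Set.range ω)
  · obtain ⟨c, hc⟩ := Finsupp.mem_span_range_iff_exists_finsupp.1 hmem
    refine absurd (isExpAlgebraic_of_derivation c.support fun δ hδ => ?_) hl
    rw [← δ.liftKaehlerDifferential_comp_D, show KaehlerDifferential.D ℚ ℝ l = D l from rfl, ← hc,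
      map_finsuppSum]
    refine Finset.sum_eq_zero fun x hx => ?_
    simp [ω, D, hδ x hx]
  · obtain ⟨f, hf0, hf⟩ := Submodule.exists_le_ker_of_notMem hmem
    refine ⟨(f (D l))⁻¹ • f.compDer D, fun x => ?_, ?_⟩
    · have h1 : f (ω x) = 0 := hf (Submodule.subset_span ⟨x, rfl⟩)
      rw [f.map_sub, f.map_smul, sub_eq_zero, smul_eq_mul] at h1
      simp [h1]
      ring
    · simp [hf0]

/-- Theorem 1.1: if `λ` is exponentially transcendental and `y₁,…,yₙ` are positive and
multiplicatively independent, then `td(ℚ(λ, y, y^λ)/ℚ(λ)) ≥ n`. -/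
theorem real_powers_schanuel (l : ℝ) (hl : ¬ IsExpAlgebraic l)
    (n : ℕ) (y : Fin n → ℝ) (hpos : ∀ i, 0 < y i)
    (hmi : ∀ m : Fin n → ℤ, ∏ i, y i ^ m i = 1 → ∀ i, m i = 0) :
    (n : Cardinal) ≤ td (Set.range y ∪ Set.range fun i => y i ^ l) {l} := by
  obtain ⟨d, hd, hdl⟩ := Derivation.exists_isExponential hl
  exact le_td_of_isExponential hd hdl hpos hmi
end

section
/- Let λ ∈ ℝ with λ > 0 be exponentially transcendental. Then the family of real numbers (λ^{λ^n})_{n ∈ ℕ}, i.e. λ, λ^λ, λ^{λ²}, λ^{λ³}, …, is algebraically independent over ℚ (here λ^{λ^n} denotes the real power exp(λ^n · log λ)). -/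
open Filter Topology MvPolynomial

theorem Polynomial.tendsto_mul_eval_exp_atTop {P : Polynomial ℝ} (hP : 0 < P.leadingCoeff) :
    Tendsto (fun s : ℝ => s * P.eval (Real.exp s)) atTop atTop := by
  by_cases hdeg : 0 < P.degree
  · exact tendsto_id.atTop_mul_atTop₀
      ((P.tendsto_atTop_of_leadingCoeff_nonneg hdeg hP.le).comp Real.tendsto_exp_atTop)
  · rw [Polynomial.eq_C_of_degree_le_zero (not_lt.mp hdeg)] at hP ⊢
    simp only [Polynomial.leadingCoeff_C, Polynomial.eval_C] at hP ⊢
    exact tendsto_id.atTop_mul_const hP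

theorem Polynomial.exists_forall_leadingCoeff_sub_pos {S : Finset (Polynomial ℝ)}
    (hS : S.Nonempty) : ∃ M ∈ S, ∀ P ∈ S, P ≠ M → 0 < (M - P).leadingCoeff := by
  have key : ∀ᶠ s : ℝ in atTop, ∀ M ∈ S, ∀ P ∈ S, 0 < (M - P).leadingCoeff →
      0 < s * (M - P).eval (Real.exp s) := by
    simp only [eventually_all_finset, eventually_imp_distrib_left]
    exact fun M _ P _ h => (tendsto_mul_eval_exp_atTop h).eventually_gt_atTop 0
  obtain ⟨s, hs⟩ := key.exists
  obtain ⟨M, hM, hmax⟩ := S.exists_max_image (fun P => s * P.eval (Real.exp s)) hS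
  refine ⟨M, hM, fun P hP hne => ?_⟩
  by_contra hneg
  have hlt : 0 < (P - M).leadingCoeff := by
    rw [← neg_sub, Polynomial.leadingCoeff_neg]
    have : (M - P).leadingCoeff ≠ 0 := by simpa [sub_eq_zero] using hne.symm
    exact neg_pos.mpr (lt_of_le_of_ne (not_lt.mp hneg) this)
  have h1 := hs P hP M hM hlt
  have h2 := hmax P hP
  rw [Polynomial.eval_sub, mul_sub] at h1
  linarith

/-- Distinct real polynomials `P` give linearly independent functions `s ↦ exp (s * P (exp s))`. -/
theorem linearIndependent_exp_mul_eval_exp :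
    LinearIndependent ℝ
      (fun (P : Polynomial ℝ) (s : ℝ) => Real.exp (s * P.eval (Real.exp s))) := by
  rw [linearIndependent_iff]
  intro c hc
  by_contra hne
  obtain ⟨M, hM, hmax⟩ :=
    Polynomial.exists_forall_leadingCoeff_sub_pos (Finsupp.support_nonempty_iff.mpr hne)
  have hlim : Tendsto (fun s : ℝ => ∑ P ∈ c.support,
      c P * Real.exp (-(s * (M - P).eval (Real.exp s)))) atTop
      (𝓝 (∑ P ∈ c.support, if P = M then c M else 0)) := by
    refine tendsto_finsetSum _ fun P hP => ?_
    split_ifs with h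
    · simp [h]
    · simpa using (Real.tendsto_exp_neg_atTop_nhds_zero.comp
        (Polynomial.tendsto_mul_eval_exp_atTop (hmax P hP h))).const_mul (c P)
  have hzero : ∀ s : ℝ, ∑ P ∈ c.support,
      c P * Real.exp (-(s * (M - P).eval (Real.exp s))) = 0 := by
    intro s
    have h := congrFun hc s
    simp only [Finsupp.linearCombination_apply, Finsupp.sum, Finset.sum_apply, Pi.smul_apply,
      smul_eq_mul, Pi.zero_apply] at h
    rw [← zero_mul (Real.exp (-(s * M.eval (Real.exp s)))), ← h, Finset.sum_mul]
    refine Finset.sum_congr rfl fun P _ => ?_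
    rw [mul_assoc, ← Real.exp_add, Polynomial.eval_sub]
    ring_nf
  simp only [hzero, Finset.sum_ite_eq', hM, if_true] at hlim
  exact Finsupp.mem_support_iff.mp hM (tendsto_nhds_unique tendsto_const_nhds hlim).symm

/-- The functions `s ↦ exp (s * exp s ^ n)`, for `n : ℕ`, are algebraically independent. -/
theorem algebraicIndependent_exp_mul_exp_pow :
    AlgebraicIndependent ℝ (fun (n : ℕ) (s : ℝ) => Real.exp (s * Real.exp s ^ n)) := by
  rw [algebraicIndependent_iff]
  intro p hp
  let φ : (ℕ →₀ ℕ) → Polynomial ℝ := fun m => m.sum fun i k => Polynomial.monomial i (k : ℝ)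
  have hcoeff : ∀ m i, (φ m).coeff i = m i := by
    intro m i
    simp only [φ, Finsupp.sum, Polynomial.finsetSum_coeff, Polynomial.coeff_monomial]
    simp +contextual [Finset.sum_ite_eq']
  have hφ : Function.Injective φ := fun m m' h => by
    ext i
    have := congrArg (fun P => Polynomial.coeff P i) h
    simpa [hcoeff] using this
  have hli := linearIndependent_iff'.mp (linearIndependent_exp_mul_eval_exp.comp φ hφ)
    p.support (fun m => p.coeff m) ?_
  · rw [← MvPolynomial.support_eq_empty, Finset.eq_empty_iff_forall_notMem]
    exact fun m hm => MvPolynomial.mem_support_iff.mp hm (hli m hm)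
  rw [← hp]
  ext s
  rw [MvPolynomial.aeval_def, MvPolynomial.eval₂_eq]
  simp only [Finset.sum_apply, Pi.smul_apply, Pi.mul_apply, Finset.prod_apply, Pi.pow_apply,
    Function.comp_apply, smul_eq_mul]
  refine Finset.sum_congr rfl fun m _ => ?_
  simp only [← Real.exp_nat_mul, ← Real.exp_sum, φ, Finsupp.sum, Polynomial.eval_finsetSum,
    Polynomial.eval_monomial, Finset.mul_sum]
  congr 2
  exact Finset.sum_congr rfl fun i _ => by ring

section ExponentialSystems

variable {ι : Type*}

/-- The point `(x, exp x)` on the graph of the exponential map. -/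
noncomputable def expGraph (x : ι → ℝ) : ι ⊕ ι → ℝ :=
  Sum.elim x fun j => Real.exp (x j)

/-- The derivation on exponential polynomials with `Xⱼ ↦ dⱼ` and `Yⱼ ↦ Yⱼ * dⱼ`. -/
noncomputable def expDerivation (d : ι → MvPolynomial (ι ⊕ ι) ℤ) :
    Derivation ℤ (MvPolynomial (ι ⊕ ι) ℤ) (MvPolynomial (ι ⊕ ι) ℤ) :=
  mkDerivation ℤ (Sum.elim d fun j => X (Sum.inr j) * d j)

theorem expDerivation_apply [Fintype ι] (d : ι → MvPolynomial (ι ⊕ ι) ℤ)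
    (p : MvPolynomial (ι ⊕ ι) ℤ) :
    expDerivation d p =
      ∑ j, (pderiv (Sum.inl j) p + X (Sum.inr j) * pderiv (Sum.inr j) p) * d j := by
  classical
  have h : expDerivation d =
      ∑ j, d j • (pderiv (R := ℤ) (Sum.inl j) +
        (X (Sum.inr j) : MvPolynomial (ι ⊕ ι) ℤ) • pderiv (Sum.inr j)) := by
    refine MvPolynomial.derivation_ext fun i => ?_
    rw [← Derivation.coeFnAddMonoidHom_apply, ← Derivation.coeFnAddMonoidHom_apply, map_sum]
    rcases i with i | i <;>
      simp [expDerivation, Pi.single_apply, mul_comm]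
  rw [h, ← Derivation.coeFnAddMonoidHom_apply, map_sum]
  simp [mul_comm, mul_add]

theorem hasDerivAt_aeval_expGraph {x : ℝ → ι → ℝ} {d : ι → MvPolynomial (ι ⊕ ι) ℤ}
    (hx : ∀ s j, HasDerivAt (fun s => x s j) (aeval (expGraph (x s)) (d j)) s)
    (p : MvPolynomial (ι ⊕ ι) ℤ) (s : ℝ) :
    HasDerivAt (fun s => aeval (expGraph (x s)) p)
      (aeval (expGraph (x s)) (expDerivation d p)) s := by
  induction p using MvPolynomial.induction_on with
  | C c => simpa using hasDerivAt_const s (c : ℝ)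
  | add p q hp hq => simpa using hp.fun_add hq
  | mul_X p i hp =>
    have hi : HasDerivAt (fun s => expGraph (x s) i)
        (aeval (expGraph (x s)) (expDerivation d (X i))) s := by
      rcases i with i | i
      · simpa [expGraph, expDerivation] using hx s i
      · simpa [expGraph, expDerivation] using (hx s i).exp
    simpa [add_comm, mul_comm] using hp.fun_mul hi

/-- A zero of a nonzero analytic exponential polynomial function along a path is a simple zero
of one of its iterated derivatives. -/
theorem exists_simple_zero_expDerivation {x : ℝ → ι → ℝ} {d : ι → MvPolynomial (ι ⊕ ι) ℤ}
    (hx : ∀ s j, HasDerivAt (fun s => x s j) (aeval (expGraph (x s)) (d j)) s)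
    (han : ∀ s j, AnalyticAt ℝ (fun s => x s j) s) {p : MvPolynomial (ι ⊕ ι) ℤ}
    (hne : (fun s => aeval (expGraph (x s)) p) ≠ (0 : ℝ → ℝ)) {s₀ : ℝ}
    (h0 : aeval (expGraph (x s₀)) p = 0) :
    ∃ q, aeval (expGraph (x s₀)) q = 0 ∧
      aeval (expGraph (x s₀)) (expDerivation d q) ≠ 0 := by
  by_contra! hq
  have hit : ∀ k s, iteratedDeriv k (fun s => aeval (expGraph (x s)) p) s =
      aeval (expGraph (x s)) ((expDerivation d)^[k] p) := by
    intro k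
    induction k with
    | zero => simp
    | succ k ih =>
      intro s
      rw [iteratedDeriv_succ, funext ih, Function.iterate_succ_apply']
      exact (hasDerivAt_aeval_expGraph hx _ s).deriv
  have hzero : ∀ k, aeval (expGraph (x s₀)) ((expDerivation d)^[k] p) = 0 := by
    intro k
    induction k with
    | zero => simpa using h0
    | succ k ih => rw [Function.iterate_succ_apply']; exact hq _ ih
  have hf : ∀ s, AnalyticAt ℝ (fun s => aeval (expGraph (x s)) p) s := fun s =>
    AnalyticAt.aeval_mvPolynomial (fun i => by
      rcases i with i | i
      · exact han s i
      · exact (han s i).rexp) p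
  refine hne ((AnalyticOnNhd.analyticOrderAt_eq_top_iff_eq_zero s₀ hf).mp ?_)
  refine ENat.eq_top_iff_forall_ge.mpr fun n => ?_
  rw [natCast_le_analyticOrderAt_iff_iteratedDeriv_eq_zero (hf s₀)]
  exact fun k _ => (hit k s₀).trans (hzero k)

/-- A system of integral exponential polynomials whose Jacobian has trivial kernel at a common
zero witnesses that the first coordinate of that zero is exponentially algebraic. -/
theorem isExpAlgebraic_of_forall_jacobian {n : ℕ} (x : Fin (n + 1) → ℝ)
    (f : Fin (n + 1) → MvPolynomial (Fin (n + 1) ⊕ Fin (n + 1)) ℤ)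
    (hf : ∀ i, aeval (expGraph x) (f i) = 0)
    (hJ : ∀ v : Fin (n + 1) → ℝ,
      (∀ i, ∑ j, (aeval (expGraph x) (pderiv (Sum.inl j) (f i)) +
        Real.exp (x j) * aeval (expGraph x) (pderiv (Sum.inr j) (f i))) * v j = 0) → v = 0) :
    IsExpAlgebraic (x 0) := by
  refine ⟨n + 1, n.succ_pos, x, fun i => map (Int.castRingHom ℝ) (f i), rfl, fun i m => ?_,
    fun i => ?_, fun hdet => ?_⟩
  · rw [coeff_map]
    exact intCast_mem _ _
  · rw [eval_map]
    exact hf i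
  · obtain ⟨v, hv, hv0⟩ := Matrix.exists_mulVec_eq_zero_iff.mpr hdet
    refine hv (hJ v fun i => ?_)
    have := congrFun hv0 i
    simpa only [Matrix.mulVec, dotProduct, Matrix.of_apply, pderiv_map, eval_map] using! this

end ExponentialSystems

/-- The path `s ↦ (exp s, s, s * exp s ^ a₀, s * exp s ^ a₁, …)`. -/
noncomputable def towerPath {N : ℕ} (a : Fin N → ℕ) (s : ℝ) : Fin (N + 2) → ℝ :=
  Fin.cons (Real.exp s) (Fin.cons s fun i => s * Real.exp s ^ a i)

/-- Exponential polynomials computing the velocity of `towerPath a`. -/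
noncomputable def towerVelocity {N : ℕ} (a : Fin N → ℕ) :
    Fin (N + 2) → MvPolynomial (Fin (N + 2) ⊕ Fin (N + 2)) ℤ :=
  Fin.cons (X (Sum.inl 0)) (Fin.cons 1 fun i =>
    X (Sum.inl 0) ^ a i + (a i : MvPolynomial _ ℤ) * X (Sum.inl 1) * X (Sum.inl 0) ^ a i)

theorem hasDerivAt_towerPath {N : ℕ} (a : Fin N → ℕ) (s : ℝ) (j : Fin (N + 2)) :
    HasDerivAt (fun s => towerPath a s j)
      (aeval (expGraph (towerPath a s)) (towerVelocity a j)) s := by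
  refine Fin.cases ?_ (fun j => Fin.cases ?_ (fun i => ?_) j) j
  · simpa [towerPath, towerVelocity, expGraph] using Real.hasDerivAt_exp s
  · simpa [towerPath, towerVelocity, expGraph] using hasDerivAt_id' s
  · have h := (hasDerivAt_id s).mul ((((hasDerivAt_id s).const_mul (a i : ℝ))).exp)
    simp only [id] at h
    simp only [towerPath, towerVelocity, expGraph, Fin.cons_succ, map_add, map_mul, map_pow,
      aeval_X, Sum.elim_inl, Fin.cons_zero, Fin.cons_one, map_natCast, ← Real.exp_nat_mul]
    convert! h using 1
    ring

theorem analyticAt_towerPath {N : ℕ} (a : Fin N → ℕ) (s : ℝ) (j : Fin (N + 2)) :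
    AnalyticAt ℝ (fun s => towerPath a s j) s := by
  refine Fin.cases ?_ (fun j => Fin.cases ?_ (fun i => ?_) j) j <;>
    simp only [towerPath, Fin.cons_succ, Fin.cons_zero] <;> fun_prop

/-- If an exponential polynomial function along `towerPath a` has a simple zero at `s`, then
`exp s` is exponentially algebraic. -/
theorem isExpAlgebraic_exp_of_simple_zero {N : ℕ} (a : Fin N → ℕ) {s : ℝ}
    {q : MvPolynomial (Fin (N + 2) ⊕ Fin (N + 2)) ℤ}
    (hq : aeval (expGraph (towerPath a s)) q = 0)
    (hq' : aeval (expGraph (towerPath a s)) (expDerivation (towerVelocity a) q) ≠ 0) :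
    IsExpAlgebraic (Real.exp s) := by
  refine isExpAlgebraic_of_forall_jacobian (towerPath a s)
    (Fin.cons (X (Sum.inr 1) - X (Sum.inl 0)) (Fin.cons q fun i =>
      X (Sum.inl i.succ.succ) - X (Sum.inl 0) ^ a i * X (Sum.inl 1))) ?_ ?_
  · refine Fin.cases ?_ (Fin.cases ?_ fun i => ?_)
    · simp [expGraph, towerPath]
    · simpa using hq
    · simp [expGraph, towerPath, mul_comm]
  · intro v hv
    have hv0 := hv 0
    have hvq := hv 1
    have hvi := fun i : Fin N => hv i.succ.succ
    have hvel : ∀ j, v j = v 1 * aeval (expGraph (towerPath a s)) (towerVelocity a j) := by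
      have h0 : v 0 = Real.exp s * v 1 := by
        simp [pderiv_X, Pi.single_apply, add_mul, Finset.sum_add_distrib] at hv0
        have h1 : towerPath a s 1 = s := rfl
        rw [h1] at hv0
        linarith
      refine Fin.cases ?_ (Fin.cases ?_ fun i => ?_)
      · simpa [towerVelocity, expGraph, towerPath, mul_comm] using h0
      · simp [towerVelocity]
      · have h := hvi i
        have hne0 : ∀ j : Fin N, (0 : Fin (N + 2)) ≠ j.succ.succ := fun j =>
          (Fin.succ_ne_zero _).symm
        have hne1 : ∀ j : Fin N, (1 : Fin (N + 2)) ≠ j.succ.succ := fun j h =>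
          Fin.succ_ne_zero j (Fin.succ_injective _ h.symm)
        simp [pderiv_X, Pi.single_apply, Fin.sum_univ_succ, h0, hne0, hne1, expGraph,
          towerPath] at h
        simp [towerVelocity, expGraph, towerPath]
        rcases Nat.eq_zero_or_pos (a i) with ha | ha
        · simp [ha] at h ⊢
          linarith
        · have hpow : Real.exp s ^ a i = Real.exp s ^ (a i - 1) * Real.exp s := by
            rw [← pow_succ, Nat.sub_add_cancel ha]
          rw [hpow] at h ⊢
          linarith
    have h1 : v 1 = 0 := by
      refine (mul_eq_zero.mp (?_ : v 1 * aeval (expGraph (towerPath a s))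
        (expDerivation (towerVelocity a) q) = 0)).resolve_right hq'
      rw [expDerivation_apply, map_sum, Finset.mul_sum, ← hvq]
      refine Finset.sum_congr rfl fun j _ => ?_
      rw [hvel j]
      simp [expGraph]
      ring
    funext j
    simp [hvel j, h1]

/-- If `λ > 0` is exponentially transcendental then `λ, λ^λ, λ^{λ²}, …` are
algebraically independent over `ℚ`. -/
theorem tower_powers_algebraicallyIndependent (l : ℝ) (hpos : 0 < l)
    (hl : ¬ IsExpAlgebraic l) :
    AlgebraicIndependent ℚ (fun n : ℕ => l ^ (l ^ n)) := by
  suffices h : AlgebraicIndependent ℤ (fun n : ℕ => l ^ (l ^ n)) from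
    have := IsLocalization.isAlgebraic (R := ℤ) (S := ℚ) (nonZeroDivisors ℤ)
    h.extendScalars ℚ
  rw [algebraicIndependent_iff]
  intro p hp
  obtain ⟨N, a, -, q, rfl⟩ := exists_fin_rename p
  by_contra hne
  have hexp : Real.exp (Real.log l) = l := Real.exp_log hpos
  have haeval : ∀ s, aeval (expGraph (towerPath a s))
      (rename (fun i : Fin N => (Sum.inr i.succ.succ : Fin (N + 2) ⊕ Fin (N + 2))) q) =
      aeval (fun n : ℕ => Real.exp (s * Real.exp s ^ n)) (rename a q) := by
    intro s
    rw [aeval_rename, aeval_rename]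
    rfl
  have hfun : (fun s => aeval (expGraph (towerPath a s))
      (rename (fun i : Fin N => (Sum.inr i.succ.succ : Fin (N + 2) ⊕ Fin (N + 2))) q)) ≠
      (0 : ℝ → ℝ) := by
    intro h0
    refine hne (algebraicIndependent_iff.mp
      (algebraicIndependent_exp_mul_exp_pow.restrictScalars (R := ℤ)
        (algebraMap ℤ ℝ).injective_int) _ ?_)
    rw [← h0]
    funext s
    rw [haeval]
    exact comp_aeval_apply (φ := Pi.evalAlgHom ℤ (fun _ : ℝ => ℝ) s) _ _
  obtain ⟨r, hr, hr'⟩ := exists_simple_zero_expDerivation (hasDerivAt_towerPath a)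
    (analyticAt_towerPath a) hfun (s₀ := Real.log l) (by
      rw [haeval, ← hp]
      simp only [hexp, Real.rpow_def_of_pos hpos])
  exact hl (hexp ▸ isExpAlgebraic_exp_of_simple_zero a hr hr')
end
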